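/- arXiv:2505.21637 — 4 statements merged into one kernel-verified Lean document; each statement's English description precedes it below -/
import Mathlib

section
/- Dual reformulation of the multi-source latent OT barycenter problem: the minimum value ℒ* of the barycenter problem equals the supremum of ℒ(f_{1:K}) over all K-tuples of continuous potentials f_1, …, f_K on 𝒵_B satisfying the congruence condition Σ_{k=1}^K λ_k f_k ≡ 0; that is, ℒ* = sup { ℒ(f_{1:K}) : f_1, …, f_K ∈ C(𝒵_B), Σ_{k=1}^K λ_k f_k ≡ 0 }. -/
open MeasureTheory

abbrev Euc (d : ℕ) := EuclideanSpace ℝ (Fin d)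

/-- Kantorovich optimal transport cost between two probability measures,
as an infimum over couplings (transport plans). -/
noncomputable def OTcost {d d' : ℕ} (c : Euc d → Euc d' → ℝ)
    (P : Measure (Euc d)) (Q : Measure (Euc d')) : ℝ :=
  ⨅ π : {π : Measure (Euc d × Euc d') //
      IsProbabilityMeasure π ∧ π.map Prod.fst = P ∧ π.map Prod.snd = Q},
    ∫ p, c p.1 p.2 ∂(π.1)

/-- The c-transform `f^c(x) = inf_{y ∈ ZB} [c(x,y) - f(y)]`. -/
noncomputable def ctrans {d d' : ℕ} (ZB : Set (Euc d')) (c : Euc d → Euc d' → ℝ)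
    (f : Euc d' → ℝ) (x : Euc d) : ℝ :=
  ⨅ y : ZB, (c x y - f y)


/-- **Hahn–Banach**: a sublinear functional is attained at each point by a dominated linear one. -/
lemma exists_linearMap_le_sublinear_eq {E : Type*} [AddCommGroup E] [Module ℝ E] (N : E → ℝ)
    (N_hom : ∀ c : ℝ, 0 < c → ∀ x, N (c • x) = c * N x)
    (N_add : ∀ x y, N (x + y) ≤ N x + N y) (x : E) :
    ∃ L : E →ₗ[ℝ] ℝ, L x = N x ∧ ∀ y, L y ≤ N y := by
  have N_zero : N 0 = 0 := by
    have := N_hom 2 two_pos 0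
    rw [smul_zero] at this
    linarith
  have H : ∀ c : ℝ, c • x = 0 → (RingHom.id ℝ) c • N x = 0 := by
    intro c hc
    rcases smul_eq_zero.1 hc with rfl | rfl <;> simp [N_zero]
  obtain ⟨L, hL, hLN⟩ := exists_extension_of_le_sublinear
    (LinearPMap.mkSpanSingleton' x (N x) H) N N_hom N_add (by
      rintro ⟨y, hy⟩
      obtain ⟨c, rfl⟩ := Submodule.mem_span_singleton.1 hy
      rw [LinearPMap.mkSpanSingleton'_apply]
      change c * N x ≤ N (c • x)
      rcases lt_trichotomy c 0 with hc | rfl | hc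
      · have h1 := N_hom (-c) (neg_pos.2 hc) x
        have h2 := N_add (c • x) ((-c) • x)
        rw [← add_smul, add_neg_cancel, zero_smul, N_zero] at h2
        linarith
      · simp [N_zero]
      · rw [N_hom c hc])
  have hx : x ∈ (LinearPMap.mkSpanSingleton' x (N x) H).domain :=
    Submodule.mem_span_singleton_self x
  refine ⟨L, ?_, hLN⟩
  rw [← LinearPMap.mkSpanSingleton'_apply_self x (N x) H hx]
  exact hL ⟨x, hx⟩

/-- **Riesz–Markov–Kakutani** on a compact space. -/
lemma exists_measure_integral_eq_of_nonneg {X : Type*} [TopologicalSpace X] [CompactSpace X]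
    [T2Space X] [MeasurableSpace X] [BorelSpace X] (L : C(X, ℝ) →ₗ[ℝ] ℝ)
    (hL : ∀ u, (∀ x, 0 ≤ u x) → 0 ≤ L u) :
    ∃ μ : Measure X, IsFiniteMeasure μ ∧ ∀ u : C(X, ℝ), ∫ x, u x ∂μ = L u := by
  let e : CompactlySupportedContinuousMap X ℝ →ₗ[ℝ] C(X, ℝ) :=
    { toFun := fun u => u.toContinuousMap
      map_add' := fun _ _ => rfl
      map_smul' := fun _ _ => rfl }
  let Λ : CompactlySupportedContinuousMap X ℝ →ₚ[ℝ] ℝ :=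
    PositiveLinearMap.mk₀ (L ∘ₗ e) fun u hu => hL _ fun x => hu x
  refine ⟨RealRMK.rieszMeasure Λ, inferInstance, fun u => ?_⟩
  exact RealRMK.integral_rieszMeasure Λ (CompactlySupportedContinuousMap.continuousMapEquiv u)

/-- Finite Borel measures on a compact space that agree on continuous functions are equal. -/
lemma measure_eq_of_forall_integral_continuousMap_eq {X : Type*} [TopologicalSpace X]
    [MeasurableSpace X] [BorelSpace X] [HasOuterApproxClosed X]
    {μ ν : Measure X} [IsFiniteMeasure μ] [IsFiniteMeasure ν]
    (h : ∀ u : C(X, ℝ), ∫ x, u x ∂μ = ∫ x, u x ∂ν) : μ = ν :=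
  ext_of_forall_integral_eq_of_IsFiniteMeasure fun f => h f.toContinuousMap

lemma integrable_continuousMap {Z : Type*} [TopologicalSpace Z] [CompactSpace Z]
    [MeasurableSpace Z] [BorelSpace Z] (μ : Measure Z) [IsFiniteMeasure μ] (g : C(Z, ℝ)) :
    Integrable g μ :=
  g.continuous.integrable_of_hasCompactSupport (HasCompactSupport.of_compactSpace g)

section CompactDuality

variable {ι : Type*} [Fintype ι] {X : ι → Type*}
  [∀ k, TopologicalSpace (X k)] [∀ k, MeasurableSpace (X k)]
  {Y : Type*} [TopologicalSpace Y]

/-- The dual costs of the families `(g, f)` that superhedge `u`, with `f` congruent. -/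
def superhedgingValues (P : ∀ k, Measure (X k)) (lam : ι → ℝ) (u : ∀ k, C(X k × Y, ℝ)) : Set ℝ :=
  {r | ∃ (g : ∀ k, C(X k, ℝ)) (f : ι → C(Y, ℝ)), (∀ y, ∑ k, lam k * f k y = 0) ∧
    (∀ k x y, u k (x, y) ≤ g k x + f k y) ∧ r = ∑ k, lam k * ∫ x, g k x ∂P k}

variable {P : ∀ k, Measure (X k)} {lam : ι → ℝ}

lemma smul_mem_superhedgingValues {u : ∀ k, C(X k × Y, ℝ)} {r c : ℝ} (hc : 0 ≤ c)
    (hr : r ∈ superhedgingValues P lam u) : c * r ∈ superhedgingValues P lam (c • u) := by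
  obtain ⟨g, f, hf, h, rfl⟩ := hr
  refine ⟨c • g, c • f, fun y => ?_, fun k x y => ?_, ?_⟩
  · simp [mul_left_comm _ c, ← Finset.mul_sum, hf]
  · have := mul_le_mul_of_nonneg_left (h k x y) hc
    simpa [mul_add] using this
  · simp [Finset.mul_sum, integral_const_mul, mul_left_comm c]

lemma superhedgingValues_nonempty [∀ k, CompactSpace (X k)] [CompactSpace Y]
    (u : ∀ k, C(X k × Y, ℝ)) :
    (superhedgingValues P lam u).Nonempty :=
  ⟨_, fun k => ContinuousMap.const _ ‖u k‖, 0, by simp,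
    fun k x y => by simpa using (le_abs_self _).trans ((u k).norm_coe_le_norm (x, y)), rfl⟩

variable [∀ k, CompactSpace (X k)] [∀ k, BorelSpace (X k)]

lemma add_mem_superhedgingValues [∀ k, IsFiniteMeasure (P k)] {u v : ∀ k, C(X k × Y, ℝ)}
    {r s : ℝ} (hr : r ∈ superhedgingValues P lam u) (hs : s ∈ superhedgingValues P lam v) :
    r + s ∈ superhedgingValues P lam (u + v) := by
  obtain ⟨g, f, hf, h, rfl⟩ := hr
  obtain ⟨g', f', hf', h', rfl⟩ := hs
  refine ⟨g + g', f + f', fun y => ?_, fun k x y => ?_, ?_⟩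
  · simp [mul_add, Finset.sum_add_distrib, hf, hf']
  · have := h k x y
    have := h' k x y
    simp only [Pi.add_apply, ContinuousMap.add_apply]
    linarith
  · rw [← Finset.sum_add_distrib]
    refine Finset.sum_congr rfl fun k _ => ?_
    rw [← mul_add, ← integral_add (integrable_continuousMap _ _) (integrable_continuousMap _ _)]
    rfl

lemma superhedgingValues_bddBelow [CompactSpace Y] [Nonempty Y] [∀ k, IsProbabilityMeasure (P k)]
    (hlam : ∀ k, 0 < lam k) (u : ∀ k, C(X k × Y, ℝ)) :
    BddBelow (superhedgingValues P lam u) := by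
  obtain ⟨y⟩ := ‹Nonempty Y›
  refine ⟨∑ k, lam k * -‖u k‖, ?_⟩
  rintro _ ⟨g, f, hf, h, rfl⟩
  rw [← add_zero (∑ k, lam k * ∫ x, g k x ∂P k), ← hf y, ← Finset.sum_add_distrib]
  refine Finset.sum_le_sum fun k _ => ?_
  have : ∫ _, (-‖u k‖ - f k y) ∂P k ≤ ∫ x, g k x ∂P k := by
    refine integral_mono (integrable_const _) (integrable_continuousMap _ _) fun x => ?_
    have h1 := h k x y
    have h2 := (abs_le.1 ((u k).norm_coe_le_norm (x, y))).1
    simp only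
    linarith
  rw [integral_const, probReal_univ, one_smul] at this
  nlinarith [hlam k]

/-- **Attainment and absence of a duality gap** for the barycenter problem on compact spaces: some
couplings with a common second marginal are matched by dual potentials up to any `ε`. -/
theorem exists_couplings_forall_exists_potentials [DecidableEq ι] [Nonempty ι]
    [∀ k, T2Space (X k)] [∀ k, SecondCountableTopology (X k)] [∀ k, HasOuterApproxClosed (X k)]
    [CompactSpace Y] [T2Space Y] [SecondCountableTopology Y] [HasOuterApproxClosed Y]
    [MeasurableSpace Y] [BorelSpace Y] [Nonempty Y] [∀ k, IsProbabilityMeasure (P k)]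
    (hlam : ∀ k, 0 < lam k) (C : ∀ k, C(X k × Y, ℝ)) :
    ∃ (Q : Measure Y) (π : ∀ k, Measure (X k × Y)), IsProbabilityMeasure Q ∧
      (∀ k, IsProbabilityMeasure (π k) ∧ (π k).map Prod.fst = P k ∧ (π k).map Prod.snd = Q) ∧
      ∀ ε > 0, ∃ (g : ∀ k, C(X k, ℝ)) (f : ι → C(Y, ℝ)), (∀ y, ∑ k, lam k * f k y = 0) ∧
        (∀ k x y, g k x + f k y ≤ C k (x, y)) ∧
        ∑ k, lam k * ∫ p, C k p ∂π k ≤ ∑ k, lam k * ∫ x, g k x ∂P k + ε := by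
  let N : (∀ k, C(X k × Y, ℝ)) → ℝ := fun u => sInf (superhedgingValues P lam u)
  have N_le {u r} (h : r ∈ superhedgingValues P lam u) : N u ≤ r :=
    csInf_le (superhedgingValues_bddBelow hlam u) h
  have N_lt u {ε : ℝ} (hε : 0 < ε) : ∃ r ∈ superhedgingValues P lam u, r < N u + ε :=
    exists_lt_of_csInf_lt (superhedgingValues_nonempty u) (lt_add_of_pos_right _ hε)
  have N_smul_le (c : ℝ) (hc : 0 < c) u : N (c • u) ≤ c * N u := by
    rw [← div_le_iff₀' hc]
    refine le_csInf (superhedgingValues_nonempty u) fun r hr => ?_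
    rw [div_le_iff₀' hc]
    exact N_le (smul_mem_superhedgingValues hc.le hr)
  obtain ⟨L, hLC, hLN⟩ := exists_linearMap_le_sublinear_eq N
    (fun c hc u => le_antisymm (N_smul_le c hc u) (by
      have := N_smul_le c⁻¹ (inv_pos.2 hc) (c • u)
      rwa [inv_smul_smul₀ hc.ne', ← div_eq_inv_mul, le_div_iff₀' hc] at this))
    (fun u v => by
      refine le_of_forall_pos_le_add fun ε hε => ?_
      obtain ⟨r, hr, hr'⟩ := N_lt u (half_pos hε)
      obtain ⟨s, hs, hs'⟩ := N_lt v (half_pos hε)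
      have := N_le (add_mem_superhedgingValues hr hs)
      linarith) (-C)
  have hL {u r} (h : r ∈ superhedgingValues P lam u) : L u ≤ r := (hLN u).trans (N_le h)
  have hLsingle k (u : C(X k × Y, ℝ)) (g : C(X k, ℝ)) (h : ∀ x y, u (x, y) ≤ g x) :
      L (Pi.single k u) ≤ lam k * ∫ x, g x ∂P k := by
    refine hL ⟨Pi.single k g, 0, by simp, fun j x y => ?_, ?_⟩
    · obtain rfl | hj := eq_or_ne j k
      · simpa using h x y
      · simp [hj]
    · rw [Finset.sum_eq_single k (fun j _ hj => by simp [hj]) (by simp), Pi.single_eq_same]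
  have hpos k (u : C(X k × Y, ℝ)) (hu : ∀ p, 0 ≤ u p) :
      0 ≤ ((lam k)⁻¹ • L ∘ₗ LinearMap.single ℝ (fun k => C(X k × Y, ℝ)) k) u := by
    have h := hLsingle k (-u) 0 fun x y => by simpa using hu (x, y)
    rw [Pi.single_neg, map_neg] at h
    simp only [ContinuousMap.zero_apply, integral_zero, mul_zero, neg_nonpos] at h
    exact mul_nonneg (inv_pos.2 (hlam k)).le h
  choose π hπfin hπ using fun k => exists_measure_integral_eq_of_nonneg _ (hpos k)
  replace hπ k (u : C(X k × Y, ℝ)) : lam k * ∫ p, u p ∂π k = L (Pi.single k u) := by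
    rw [hπ]
    simp [mul_inv_cancel_left₀ (hlam k).ne']
  have hfst k : (π k).map Prod.fst = P k := by
    refine measure_eq_of_forall_integral_continuousMap_eq fun g => ?_
    rw [integral_map measurable_fst.aemeasurable g.continuous.aestronglyMeasurable]
    have h1 := hπ k (g.comp ContinuousMap.fst)
    have h2 := hLsingle k (g.comp ContinuousMap.fst) g fun x y => le_rfl
    have h3 := hLsingle k (-g.comp ContinuousMap.fst) (-g) fun x y => le_rfl
    simp only [Pi.single_neg, map_neg, ContinuousMap.neg_apply, integral_neg] at h3
    refine mul_left_cancel₀ (hlam k).ne' (h1.trans (le_antisymm h2 (by linarith)))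
  have hprob k : IsProbabilityMeasure (π k) := by
    have : IsProbabilityMeasure ((π k).map Prod.fst) := hfst k ▸ inferInstance
    exact Measure.isProbabilityMeasure_of_map Prod.fst
  have hsnd_le i j (f : C(Y, ℝ)) : ∫ p, f p.2 ∂π i ≤ ∫ p, f p.2 ∂π j := by
    have h1 := hπ i ((lam i)⁻¹ • f.comp ContinuousMap.snd)
    have h2 := hπ j ((lam j)⁻¹ • f.comp ContinuousMap.snd)
    simp only [ContinuousMap.smul_apply, smul_eq_mul, integral_const_mul,
      mul_inv_cancel_left₀ (hlam _).ne'] at h1 h2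
    change ∫ p, f p.2 ∂π i = _ at h1
    change ∫ p, f p.2 ∂π j = _ at h2
    rw [h1, h2, ← sub_nonpos, ← map_sub]
    refine hL ⟨0, Pi.single i ((lam i)⁻¹ • f) - Pi.single j ((lam j)⁻¹ • f), fun y => ?_,
      fun k x y => ?_, by simp⟩
    · have key l : ∑ k, lam k * (Pi.single l ((lam l)⁻¹ • f) : ι → C(Y, ℝ)) k y = f y := by
        rw [Finset.sum_eq_single l (fun k _ hk => by simp [hk]) (by simp)]
        simp [mul_inv_cancel_left₀ (hlam l).ne']
      simp [mul_sub, key]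
    · have key l : (Pi.single l ((lam l)⁻¹ • f.comp ContinuousMap.snd) : ∀ k, C(X k × Y, ℝ)) k
          (x, y) = (Pi.single l ((lam l)⁻¹ • f) : ι → C(Y, ℝ)) k y := by
        obtain rfl | hl := eq_or_ne k l
        · simp
        · simp [hl]
      simp [key]
  obtain ⟨k₀⟩ := ‹Nonempty ι›
  have hsnd k : (π k).map Prod.snd = (π k₀).map Prod.snd := by
    refine measure_eq_of_forall_integral_continuousMap_eq fun f => ?_
    rw [integral_map measurable_snd.aemeasurable f.continuous.aestronglyMeasurable,
      integral_map measurable_snd.aemeasurable f.continuous.aestronglyMeasurable]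
    exact le_antisymm (hsnd_le _ _ f) (hsnd_le _ _ f)
  refine ⟨(π k₀).map Prod.snd, π, Measure.isProbabilityMeasure_map measurable_snd.aemeasurable,
    fun k => ⟨hprob k, hfst k, hsnd k⟩, fun ε hε => ?_⟩
  obtain ⟨_, ⟨g, f, hf, h, rfl⟩, hr⟩ := N_lt (-C) hε
  refine ⟨-g, -f, fun y => by simp [hf], fun k x y => ?_, ?_⟩
  · have := h k x y
    simp only [Pi.neg_apply, ContinuousMap.neg_apply] at this ⊢
    linarith
  · simp_rw [hπ, ← map_sum, Finset.univ_sum_single, Pi.neg_apply, ContinuousMap.neg_apply,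
      integral_neg, mul_neg, Finset.sum_neg_distrib]
    rw [map_neg] at hLC
    linarith

end CompactDuality

lemma integrable_of_continuousOn_of_ae_mem {E : Type*} [TopologicalSpace E] [T2Space E]
    [MeasurableSpace E] [BorelSpace E] {K : Set E} {f : E → ℝ}
    {μ : Measure E} [IsFiniteMeasure μ] (hK : IsCompact K) (hf : ContinuousOn f K)
    (hμ : ∀ᵐ x ∂μ, x ∈ K) : Integrable f μ := by
  have := hf.integrableOn_compact (μ := μ) hK
  rwa [IntegrableOn, Measure.restrict_eq_self_of_ae_mem hμ] at this

section Coupling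

variable {d d' : ℕ} {Z : Set (Euc d)} {ZB : Set (Euc d')} {c : Euc d → Euc d' → ℝ}
  {P : Measure (Euc d)} {Q : Measure (Euc d')}

lemma continuousOn_ctrans (hZB : IsCompact ZB)
    (hc : ContinuousOn (fun p : Euc d × Euc d' => c p.1 p.2) (Z ×ˢ ZB))
    {f : Euc d' → ℝ} (hf : ContinuousOn f ZB) : ContinuousOn (ctrans ZB c f) Z := by
  rw [continuousOn_iff_continuous_domRestrict]
  have := isCompact_iff_compactSpace.1 hZB
  have h : Continuous (fun p : Z × ZB => c p.1 p.2 - f p.2) :=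
    (hc.comp_continuous (f := fun p : Z × ZB => ((p.1 : Euc d), (p.2 : Euc d'))) (by fun_prop)
      fun p => ⟨p.1.2, p.2.2⟩).sub (hf.comp_continuous (by fun_prop) fun p => p.2.2)
  have h' := isCompact_univ.continuous_sInf (f := fun (x : Z) (y : ZB) => c x y - f y) h
  simp only [Set.image_univ] at h'
  exact h'

lemma ctrans_le (hZB : IsCompact ZB)
    (hc : ContinuousOn (fun p : Euc d × Euc d' => c p.1 p.2) (Z ×ˢ ZB))
    {f : Euc d' → ℝ} (hf : ContinuousOn f ZB) {x : Euc d} (hx : x ∈ Z) {y : Euc d'}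
    (hy : y ∈ ZB) : ctrans ZB c f x ≤ c x y - f y := by
  have h : ContinuousOn (fun y => c x y - f y) ZB :=
    (hc.comp (f := fun y => (x, y)) (by fun_prop) fun y hy => ⟨hx, hy⟩).sub hf
  refine ciInf_le (f := fun y : ZB => c x y - f y) ?_ ⟨y, hy⟩
  convert hZB.bddBelow_image h
  rw [Set.image_eq_range]

lemma ae_mem_prod_of_coupling (hZ : MeasurableSet Z) (hZB : MeasurableSet ZB)
    [IsProbabilityMeasure P] [IsProbabilityMeasure Q] (hP : P Z = 1) (hQ : Q ZB = 1)
    {π : Measure (Euc d × Euc d')} (h₁ : π.map Prod.fst = P) (h₂ : π.map Prod.snd = Q) :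
    ∀ᵐ p ∂π, p ∈ Z ×ˢ ZB := by
  have hP' : ∀ᵐ x ∂π.map Prod.fst, x ∈ Z := h₁ ▸ (mem_ae_iff_prob_eq_one hZ).2 hP
  have hQ' : ∀ᵐ y ∂π.map Prod.snd, y ∈ ZB := h₂ ▸ (mem_ae_iff_prob_eq_one hZB).2 hQ
  filter_upwards [ae_of_ae_map measurable_fst.aemeasurable hP',
    ae_of_ae_map measurable_snd.aemeasurable hQ'] with p h h' using ⟨h, h'⟩

lemma integral_nonneg_of_coupling (hZ : MeasurableSet Z) (hZB : MeasurableSet ZB)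
    [IsProbabilityMeasure P] [IsProbabilityMeasure Q] (hP : P Z = 1) (hQ : Q ZB = 1)
    (hc : ∀ x ∈ Z, ∀ y ∈ ZB, 0 ≤ c x y)
    {π : Measure (Euc d × Euc d')} (h₁ : π.map Prod.fst = P) (h₂ : π.map Prod.snd = Q) :
    0 ≤ ∫ p, c p.1 p.2 ∂π :=
  integral_nonneg_of_ae <| (ae_mem_prod_of_coupling hZ hZB hP hQ h₁ h₂).mono
    fun _ hp => hc _ hp.1 _ hp.2

/-- Weak Kantorovich duality. -/
lemma integral_ctrans_add_integral_le_OTcost (hZ : IsCompact Z) (hZB : IsCompact ZB)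
    [IsProbabilityMeasure P] [IsProbabilityMeasure Q] (hP : P Z = 1) (hQ : Q ZB = 1)
    (hc : ContinuousOn (fun p : Euc d × Euc d' => c p.1 p.2) (Z ×ˢ ZB))
    {f : Euc d' → ℝ} (hf : ContinuousOn f ZB) :
    ∫ x, ctrans ZB c f x ∂P + ∫ y, f y ∂Q ≤ OTcost c P Q := by
  have : Nonempty {π : Measure (Euc d × Euc d') //
      IsProbabilityMeasure π ∧ π.map Prod.fst = P ∧ π.map Prod.snd = Q} :=
    ⟨P.prod Q, inferInstance, by simp, by simp⟩
  refine le_ciInf ?_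
  rintro ⟨π, hπ, h₁, h₂⟩
  have hmem := ae_mem_prod_of_coupling hZ.measurableSet hZB.measurableSet hP hQ h₁ h₂
  have hint₁ := integrable_of_continuousOn_of_ae_mem hZ (continuousOn_ctrans hZB hc hf)
    ((mem_ae_iff_prob_eq_one hZ.measurableSet).2 hP)
  have hint₂ := integrable_of_continuousOn_of_ae_mem hZB hf
    ((mem_ae_iff_prob_eq_one hZB.measurableSet).2 hQ)
  rw [← h₁] at hint₁
  rw [← h₂] at hint₂
  calc ∫ x, ctrans ZB c f x ∂P + ∫ y, f y ∂Q
      = ∫ p, (ctrans ZB c f p.1 + f p.2) ∂π := by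
        rw [← h₁, ← h₂, integral_map measurable_fst.aemeasurable hint₁.1,
          integral_map measurable_snd.aemeasurable hint₂.1, ← integral_add]
        exacts [hint₁.comp_measurable measurable_fst, hint₂.comp_measurable measurable_snd]
    _ ≤ ∫ p, c p.1 p.2 ∂π := by
        refine integral_mono_ae ((hint₁.comp_measurable measurable_fst).add
          (hint₂.comp_measurable measurable_snd))
          (integrable_of_continuousOn_of_ae_mem (hZ.prod hZB) hc hmem) ?_
        filter_upwards [hmem] with p hp
        have := ctrans_le hZB hc hf hp.1 hp.2
        linarith

end Coupling

lemma map_val_comap_val {E : Type*} [MeasurableSpace E] {μ : Measure E} [IsProbabilityMeasure μ]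
    {s : Set E} (hs : MeasurableSet s) (hμ : μ s = 1) :
    (μ.comap (Subtype.val : s → E)).map Subtype.val = μ := by
  rw [map_comap_subtype_coe hs, Measure.restrict_eq_self_of_ae_mem]
  exact (mem_ae_iff_prob_eq_one hs).2 hμ

section Barycenter

variable {ι : Type*} [Fintype ι] {d : ι → ℕ} {d' : ℕ} {Z : ∀ k, Set (Euc (d k))}
  {ZB : Set (Euc d')} {P : ∀ k, Measure (Euc (d k))} [∀ k, IsProbabilityMeasure (P k)]
  {C : ∀ k, Euc (d k) → Euc d' → ℝ} {lam : ι → ℝ}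

/-- Weak duality for the barycenter problem. -/
lemma sum_integral_ctrans_le_sum_OTcost (hZ : ∀ k, IsCompact (Z k)) (hZB : IsCompact ZB)
    (hP : ∀ k, P k (Z k) = 1)
    (hC : ∀ k, ContinuousOn (fun p : Euc (d k) × Euc d' => C k p.1 p.2) (Z k ×ˢ ZB))
    (hlam : ∀ k, 0 < lam k) {f : ι → Euc d' → ℝ} (hf : ∀ k, ContinuousOn (f k) ZB)
    (hf₀ : ∀ y ∈ ZB, ∑ k, lam k * f k y = 0)
    {Q : Measure (Euc d')} [IsProbabilityMeasure Q] (hQ : Q ZB = 1) :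
    ∑ k, lam k * ∫ z, ctrans ZB (C k) (f k) z ∂P k ≤ ∑ k, lam k * OTcost (C k) (P k) Q := by
  have hQ' : ∀ᵐ y ∂Q, y ∈ ZB := (mem_ae_iff_prob_eq_one hZB.measurableSet).2 hQ
  have hcong : ∑ k, lam k * ∫ y, f k y ∂Q = 0 := by
    simp_rw [← integral_const_mul]
    rw [← integral_finsetSum _ fun k _ =>
      (integrable_of_continuousOn_of_ae_mem hZB (hf k) hQ').const_mul _]
    exact integral_eq_zero_of_ae (hQ'.mono hf₀)
  rw [← add_zero (∑ k, lam k * ∫ z, _ ∂P k), ← hcong, ← Finset.sum_add_distrib]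
  refine Finset.sum_le_sum fun k _ => ?_
  rw [← mul_add]
  exact mul_le_mul_of_nonneg_left
    (integral_ctrans_add_integral_le_OTcost (hZ k) hZB (hP k) hQ (hC k) (hf k)) (hlam k).le

/-- Strong duality for the barycenter problem, with an optimal `Q`. -/
lemma exists_measure_forall_exists_potentials [Nonempty ι] (hZ : ∀ k, IsCompact (Z k))
    (hZB : IsCompact ZB) (hZBne : ZB.Nonempty) (hP : ∀ k, P k (Z k) = 1)
    (hC : ∀ k, ContinuousOn (fun p : Euc (d k) × Euc d' => C k p.1 p.2) (Z k ×ˢ ZB))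
    (hC₀ : ∀ k, ∀ x ∈ Z k, ∀ y ∈ ZB, 0 ≤ C k x y) (hlam : ∀ k, 0 < lam k) :
    ∃ Q : Measure (Euc d'), IsProbabilityMeasure Q ∧ Q ZB = 1 ∧ ∀ ε > 0,
      ∃ f : ι → Euc d' → ℝ, (∀ k, ContinuousOn (f k) ZB) ∧
        (∀ y ∈ ZB, ∑ k, lam k * f k y = 0) ∧
        ∑ k, lam k * OTcost (C k) (P k) Q ≤
          ∑ k, lam k * ∫ z, ctrans ZB (C k) (f k) z ∂P k + ε := by
  classical
  have := fun k => isCompact_iff_compactSpace.1 (hZ k)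
  have := isCompact_iff_compactSpace.1 hZB
  have := hZBne.to_subtype
  have hemb k := MeasurableEmbedding.subtype_coe (hZ k).measurableSet
  have hembB := MeasurableEmbedding.subtype_coe hZB.measurableSet
  let P' k : Measure (Z k) := (P k).comap Subtype.val
  have hP' k : (P' k).map Subtype.val = P k := map_val_comap_val (hZ k).measurableSet (hP k)
  have hP'prob k : IsProbabilityMeasure (P' k) := by
    have : IsProbabilityMeasure ((P' k).map Subtype.val) := by rw [hP']; infer_instance
    exact Measure.isProbabilityMeasure_of_map Subtype.val
  let C' k : C(Z k × ZB, ℝ) := ⟨fun p => C k p.1 p.2,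
    (hC k).comp_continuous (f := fun p : Z k × ZB => ((p.1 : Euc (d k)), (p.2 : Euc d')))
      (by fun_prop) fun p => ⟨p.1.2, p.2.2⟩⟩
  obtain ⟨Q', π', hQ', hπ', hdual⟩ := exists_couplings_forall_exists_potentials (P := P') hlam C'
  have hQprob : IsProbabilityMeasure (Q'.map (Subtype.val : ZB → Euc d')) :=
    Measure.isProbabilityMeasure_map measurable_subtype_coe.aemeasurable
  have hQZB : Q'.map (Subtype.val : ZB → Euc d') ZB = 1 := by
    rw [Measure.map_apply measurable_subtype_coe hZB.measurableSet]
    simp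
  have hcost k : OTcost (C k) (P k) (Q'.map (Subtype.val : ZB → Euc d')) ≤
      ∫ p, C' k p ∂π' k := by
    obtain ⟨hprob, hfst, hsnd⟩ := hπ' k
    have he := (hemb k).prodMap hembB
    have hint : ∫ p, C' k p ∂π' k =
        ∫ p, C k p.1 p.2 ∂(π' k).map (Prod.map Subtype.val Subtype.val) := by
      rw [he.integral_map]
      rfl
    rw [hint]
    refine ciInf_le (f := fun π : {π : Measure (Euc (d k) × Euc d') // IsProbabilityMeasure π ∧
      π.map Prod.fst = P k ∧ π.map Prod.snd = Q'.map (Subtype.val : ZB → Euc d')} =>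
        ∫ p, C k p.1 p.2 ∂π.1) ⟨0, ?_⟩ ⟨_, ?_, ?_, ?_⟩
    · rintro _ ⟨⟨π, _, h₁, h₂⟩, rfl⟩
      exact integral_nonneg_of_coupling (hZ k).measurableSet hZB.measurableSet (hP k) hQZB
        (hC₀ k) h₁ h₂
    · exact Measure.isProbabilityMeasure_map he.measurable.aemeasurable
    · rw [Measure.map_map measurable_fst he.measurable, ← hP' k, ← hfst,
        Measure.map_map (hemb k).measurable measurable_fst]
      rfl
    · rw [Measure.map_map measurable_snd he.measurable, ← hsnd,
        Measure.map_map hembB.measurable measurable_snd]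
      rfl
  refine ⟨_, hQprob, hQZB, fun ε hε => ?_⟩
  obtain ⟨g, f, hf₀, hgf, hle⟩ := hdual ε hε
  have hext k (y : ZB) : Function.extend Subtype.val (f k) 0 (y : Euc d') = f k y :=
    Subtype.val_injective.extend_apply _ _ _
  have hf k : ContinuousOn (Function.extend Subtype.val (f k) 0) ZB := by
    rw [continuousOn_iff_continuous_domRestrict]
    exact (f k).continuous.congr fun y => (hext k y).symm
  refine ⟨fun k => Function.extend Subtype.val (f k) 0, hf, fun y hy => ?_, ?_⟩
  · rw [← hf₀ ⟨y, hy⟩]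
    exact Finset.sum_congr rfl fun k _ => congrArg _ (hext k ⟨y, hy⟩)
  refine (Finset.sum_le_sum fun k _ => mul_le_mul_of_nonneg_left (hcost k) (hlam k).le).trans
    (hle.trans ?_)
  gcongr with k
  · exact (hlam k).le
  rw [← hP' k, (hemb k).integral_map]
  refine integral_mono (integrable_continuousMap _ _) ?_ fun x => le_ciInf fun y => ?_
  · exact integrable_continuousMap (P' k) ⟨_, continuousOn_iff_continuous_domRestrict.1
      (continuousOn_ctrans hZB (hC k) (hf k))⟩
  · exact le_sub_iff_add_le.2 (((congrArg _ (hext k y)).le).trans (hgf k x y))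

end Barycenter

/-- **Dual reformulation of the multi-source latent OT barycenter problem.**
The minimum value ℒ* of the barycenter problem equals the supremum of ℒ(f_{1:K})
over all K-tuples of continuous potentials on 𝒵_B satisfying the congruence
condition Σ_k λ_k f_k ≡ 0. -/
theorem barycenter_dual_reformulation
    (K : ℕ) (hK : 0 < K) (d : Fin K → ℕ) (d' : ℕ)
    (Z : ∀ k : Fin K, Set (Euc (d k))) (hZc : ∀ k, IsCompact (Z k))
    (hZne : ∀ k, (Z k).Nonempty)
    (ZB : Set (Euc d')) (hZBc : IsCompact ZB) (hZBne : ZB.Nonempty)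
    (P : ∀ k : Fin K, Measure (Euc (d k))) (hPprob : ∀ k, IsProbabilityMeasure (P k))
    (hPsupp : ∀ k, P k (Z k) = 1)
    (C : ∀ k : Fin K, Euc (d k) → Euc d' → ℝ)
    (hCcont : ∀ k, ContinuousOn (fun p : Euc (d k) × Euc d' => C k p.1 p.2) (Z k ×ˢ ZB))
    (hCnonneg : ∀ k, ∀ x ∈ Z k, ∀ y ∈ ZB, 0 ≤ C k x y)
    (lam : Fin K → ℝ) (hlam : ∀ k, 0 < lam k) (hlamsum : ∑ k, lam k = 1) :
    (⨅ Q : {Q : Measure (Euc d') // IsProbabilityMeasure Q ∧ Q ZB = 1},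
        ∑ k, lam k * OTcost (C k) (P k) Q.1)
      = ⨆ f : {f : ∀ k : Fin K, Euc d' → ℝ //
            (∀ k, ContinuousOn (f k) ZB) ∧ ∀ y ∈ ZB, ∑ k, lam k * f k y = 0},
          ∑ k, lam k * ∫ z, ctrans ZB (C k) (f.1 k) z ∂(P k) := by
  have : Nonempty (Fin K) := ⟨⟨0, hK⟩⟩
  obtain ⟨Q, hQ, hQZB, hdual⟩ :=
    exists_measure_forall_exists_potentials hZc hZBc hZBne hPsupp hCcont hCnonneg hlam
  have : Nonempty {Q : Measure (Euc d') // IsProbabilityMeasure Q ∧ Q ZB = 1} :=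
    ⟨Q, hQ, hQZB⟩
  have : Nonempty {f : ∀ k : Fin K, Euc d' → ℝ //
      (∀ k, ContinuousOn (f k) ZB) ∧ ∀ y ∈ ZB, ∑ k, lam k * f k y = 0} :=
    ⟨0, fun _ => continuousOn_const, by simp⟩
  have hbdd : BddAbove (Set.range fun f : {f : ∀ k : Fin K, Euc d' → ℝ //
      (∀ k, ContinuousOn (f k) ZB) ∧ ∀ y ∈ ZB, ∑ k, lam k * f k y = 0} =>
        ∑ k, lam k * ∫ z, ctrans ZB (C k) (f.1 k) z ∂(P k)) := by
    refine ⟨∑ k, lam k * OTcost (C k) (P k) Q, ?_⟩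
    rintro _ ⟨f, rfl⟩
    exact sum_integral_ctrans_le_sum_OTcost hZc hZBc hPsupp hCcont hlam f.2.1 f.2.2 hQZB
  have hbdd' : BddBelow (Set.range fun Q : {Q : Measure (Euc d') //
      IsProbabilityMeasure Q ∧ Q ZB = 1} => ∑ k, lam k * OTcost (C k) (P k) Q.1) := by
    refine ⟨0, ?_⟩
    rintro _ ⟨⟨R, hR, hRZB⟩, rfl⟩
    refine Finset.sum_nonneg fun k _ => mul_nonneg (hlam k).le (Real.iInf_nonneg ?_)
    rintro ⟨π, _, h₁, h₂⟩
    exact integral_nonneg_of_coupling (hZc k).measurableSet hZBc.measurableSet (hPsupp k) hRZB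
      (hCnonneg k) h₁ h₂
  refine le_antisymm (le_of_forall_pos_le_add fun ε hε => ?_)
    (ciSup_le fun f => le_ciInf fun R => ?_)
  · obtain ⟨f, hf, hf₀, hle⟩ := hdual ε hε
    have h₁ := ciInf_le hbdd' ⟨Q, hQ, hQZB⟩
    have h₂ := le_ciSup hbdd ⟨f, hf, hf₀⟩
    linarith
  · have := R.2.1
    exact sum_integral_ctrans_le_sum_OTcost hZc hZBc hPsupp hCcont hlam f.2.1 f.2.2 R.2.2
end

section
/- Maximin reformulation of the barycenter problem (Eq. (8) of the paper): the minimum value ℒ* of the barycenter problem equals the supremum, over K-tuples of continuous potentials f_1, …, f_K on 𝒵_B with Σ_{k=1}^K λ_k f_k ≡ 0, of the infimum over Borel measurable maps T_k : 𝒵_k → 𝒵_B of F(f_{1:K}, T_{1:K}); that is, ℒ* = sup_{Σλ_k f_k ≡ 0} inf_{T_{1:K} Borel} F(f_{1:K}, T_{1:K}). -/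
open MeasureTheory

lemma ContinuousMap.exists_measure_integral_eq {X : Type*} [TopologicalSpace X] [T2Space X]
    [CompactSpace X] [MeasurableSpace X] [BorelSpace X] (Λ : C(X, ℝ) →ₗ[ℝ] ℝ)
    (hΛ : ∀ f, 0 ≤ f → 0 ≤ Λ f) :
    ∃ μ : Measure X, IsFiniteMeasure μ ∧ ∀ f : C(X, ℝ), ∫ x, f x ∂μ = Λ f := by
  let Φ : CompactlySupportedContinuousMap X ℝ →ₗ[ℝ] ℝ :=
    { toFun := fun f => Λ f.toContinuousMap
      map_add' := fun f g => Λ.map_add f.toContinuousMap g.toContinuousMap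
      map_smul' := fun a f => Λ.map_smul a f.toContinuousMap }
  let Ψ := PositiveLinearMap.mk₀ Φ fun f hf => hΛ _ hf
  refine ⟨RealRMK.rieszMeasure Ψ, inferInstance, fun f => ?_⟩
  exact RealRMK.integral_rieszMeasure Ψ (CompactlySupportedContinuousMap.continuousMapEquiv f)

lemma MeasureTheory.Measure.eq_of_forall_integral_continuousMap_eq {X : Type*} [MetricSpace X]
    [CompactSpace X] [MeasurableSpace X] [BorelSpace X] {μ ν : Measure X} [IsFiniteMeasure μ]
    [IsFiniteMeasure ν] (h : ∀ f : C(X, ℝ), ∫ x, f x ∂μ = ∫ x, f x ∂ν) : μ = ν :=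
  ext_of_forall_integral_eq_of_IsFiniteMeasure fun f => h f.toContinuousMap

/-- A sublinear functional on a real vector space has a linear minorant touching it at any
given point. -/
lemma exists_linearMap_le_of_sublinear {E : Type*} [AddCommGroup E] [Module ℝ E] (N : E → ℝ)
    (N_hom : ∀ c : ℝ, 0 < c → ∀ x, N (c • x) = c * N x) (N_add : ∀ x y, N (x + y) ≤ N x + N y)
    (x₀ : E) : ∃ g : E →ₗ[ℝ] ℝ, g x₀ = N x₀ ∧ ∀ x, g x ≤ N x := by
  have N_zero : N 0 = 0 := by
    have := N_hom 2 two_pos 0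
    rw [smul_zero] at this
    linarith
  have h : ∀ c : ℝ, c • x₀ = 0 → (RingHom.id ℝ) c • N x₀ = 0 := by
    intro c hc
    rcases smul_eq_zero.1 hc with rfl | rfl <;> simp [N_zero]
  obtain ⟨g, hg, hgN⟩ := exists_extension_of_le_sublinear
    (LinearPMap.mkSpanSingleton' x₀ (N x₀) h) N N_hom N_add (by
      rintro ⟨x, hx⟩
      obtain ⟨c, rfl⟩ := Submodule.mem_span_singleton.1 hx
      rw [LinearPMap.mkSpanSingleton'_apply]
      simp only [RingHom.id_apply, smul_eq_mul]
      rcases lt_trichotomy c 0 with hc | rfl | hc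
      · have h1 := N_add (c • x₀) ((-c) • x₀)
        rw [← add_smul, add_neg_cancel, zero_smul, N_zero, N_hom (-c) (by linarith)] at h1
        linarith
      · simp [N_zero]
      · exact (N_hom c hc x₀).ge)
  refine ⟨g, ?_, hgN⟩
  exact (hg ⟨x₀, Submodule.mem_span_singleton_self x₀⟩).trans
    (LinearPMap.mkSpanSingleton'_apply_self ..)

lemma ContinuousMap.integrable_of_compactSpace {Z : Type*} [TopologicalSpace Z] [CompactSpace Z]
    [MeasurableSpace Z] [OpensMeasurableSpace Z] (ν : Measure Z) [IsFiniteMeasure ν]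
    (f : C(Z, ℝ)) : Integrable f ν :=
  .of_bound f.continuous.measurable.aestronglyMeasurable ‖f‖ (ae_of_all _ f.norm_coe_le_norm)

section Duality

variable {ι : Type*} [Fintype ι] {X : ι → Type*} {Y : Type*}
  [∀ k, MetricSpace (X k)] [∀ k, MeasurableSpace (X k)] [MetricSpace Y]

/-- The values `∑ k, ∫ u k ∂(μ k)` over all splittings `φ k (x, y) ≤ u k x + f k y` with
`∑ k, f k = 0`. -/
def dominatingValues (μ : ∀ k, Measure (X k)) (φ : ∀ k, C(X k × Y, ℝ)) : Set ℝ :=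
  {r | ∃ (u : ∀ k, C(X k, ℝ)) (f : ι → C(Y, ℝ)), (∀ y, ∑ k, f k y = 0) ∧
    (∀ k x y, φ k (x, y) ≤ u k x + f k y) ∧ r = ∑ k, ∫ x, u k x ∂(μ k)}

variable (μ : ∀ k, Measure (X k))

lemma smul_mem_dominatingValues {φ : ∀ k, C(X k × Y, ℝ)} {a c : ℝ} (hc : 0 ≤ c)
    (ha : a ∈ dominatingValues μ φ) : c * a ∈ dominatingValues μ (c • φ) := by
  obtain ⟨u, f, hf, h, rfl⟩ := ha
  refine ⟨c • u, c • f, fun y => ?_, fun k x y => ?_, ?_⟩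
  · simp [← Finset.mul_sum, hf]
  · simpa [mul_add] using mul_le_mul_of_nonneg_left (h k x y) hc
  · simp [Finset.mul_sum, integral_const_mul]

variable [∀ k, CompactSpace (X k)]

lemma dominatingValues_nonempty [CompactSpace Y] (φ : ∀ k, C(X k × Y, ℝ)) : (dominatingValues μ φ).Nonempty :=
  ⟨_, fun k => .const _ ‖φ k‖, 0, by simp,
    fun k x y => by simpa using (le_abs_self _).trans ((φ k).norm_coe_le_norm (x, y)), rfl⟩

variable [∀ k, BorelSpace (X k)] [∀ k, IsProbabilityMeasure (μ k)]

lemma add_mem_dominatingValues {φ ψ : ∀ k, C(X k × Y, ℝ)} {a b : ℝ}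
    (ha : a ∈ dominatingValues μ φ) (hb : b ∈ dominatingValues μ ψ) :
    a + b ∈ dominatingValues μ (φ + ψ) := by
  obtain ⟨u, f, hf, h, rfl⟩ := ha
  obtain ⟨v, g, hg, h', rfl⟩ := hb
  refine ⟨u + v, f + g, fun y => ?_, fun k x y => ?_, ?_⟩
  · simp [Finset.sum_add_distrib, hf, hg]
  · have := h k x y
    have := h' k x y
    simp only [Pi.add_apply, ContinuousMap.add_apply]
    linarith
  · rw [← Finset.sum_add_distrib]
    refine Finset.sum_congr rfl fun k _ => ?_
    exact (integral_add ((u k).integrable_of_compactSpace _)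
      ((v k).integrable_of_compactSpace _)).symm

variable [CompactSpace Y]

lemma dominatingValues_bddBelow [Nonempty Y] (φ : ∀ k, C(X k × Y, ℝ)) :
    BddBelow (dominatingValues μ φ) := by
  refine ⟨-∑ k, ‖φ k‖, ?_⟩
  rintro _ ⟨u, f, hf, h, rfl⟩
  obtain ⟨y⟩ := ‹Nonempty Y›
  calc -∑ k, ‖φ k‖ = ∑ k, (-‖φ k‖ - f k y) := by
        rw [Finset.sum_sub_distrib, hf, sub_zero, Finset.sum_neg_distrib]
    _ = ∑ k, ∫ _, (-‖φ k‖ - f k y) ∂(μ k) := by simp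
    _ ≤ _ := Finset.sum_le_sum fun k _ =>
        integral_mono (integrable_const _) ((u k).integrable_of_compactSpace _) fun x => by
          have h1 := (neg_le_abs _).trans ((φ k).norm_coe_le_norm (x, y))
          have h2 := h k x y
          simp only
          linarith

variable [MeasurableSpace Y] [BorelSpace Y]

/-- Kantorovich-type duality for plans with prescribed first marginals and a common, free second
marginal. -/
theorem exists_plans_common_marginal [Nonempty ι] [Nonempty Y] (c : ∀ k, C(X k × Y, ℝ)) :
    ∃ (π : ∀ k, Measure (X k × Y)) (ν : Measure Y), (∀ k, (π k).map Prod.fst = μ k) ∧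
      (∀ k, (π k).map Prod.snd = ν) ∧
      ∀ ε > 0, ∃ (u : ∀ k, C(X k, ℝ)) (f : ι → C(Y, ℝ)), (∀ y, ∑ k, f k y = 0) ∧
        (∀ k x y, u k x + f k y ≤ c k (x, y)) ∧
        ∑ k, ∫ p, c k p ∂(π k) < ∑ k, ∫ x, u k x ∂(μ k) + ε := by
  classical
  let N : (∀ k, C(X k × Y, ℝ)) → ℝ := fun φ => sInf (dominatingValues μ φ)
  have N_le {φ : ∀ k, C(X k × Y, ℝ)} {a : ℝ} (ha : a ∈ dominatingValues μ φ) : N φ ≤ a :=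
    csInf_le (dominatingValues_bddBelow μ φ) ha
  have N_smul_le (a : ℝ) (ha : 0 < a) (φ : ∀ k, C(X k × Y, ℝ)) : N (a • φ) ≤ a * N φ := by
    rw [← div_le_iff₀' ha]
    refine le_csInf (dominatingValues_nonempty μ φ) fun b hb => ?_
    rw [div_le_iff₀' ha]
    exact N_le (smul_mem_dominatingValues μ ha.le hb)
  obtain ⟨g, hgc, hgN⟩ := exists_linearMap_le_of_sublinear N
    (fun a ha φ => (N_smul_le a ha φ).antisymm (by
      have := N_smul_le a⁻¹ (inv_pos.2 ha) (a • φ)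
      rwa [smul_smul, inv_mul_cancel₀ ha.ne', one_smul, le_inv_mul_iff₀ ha] at this))
    (fun φ ψ => by
      rw [← sub_le_iff_le_add]
      refine le_csInf (dominatingValues_nonempty μ φ) fun a ha => ?_
      rw [sub_le_comm]
      refine le_csInf (dominatingValues_nonempty μ ψ) fun b hb => ?_
      have := N_le (add_mem_dominatingValues μ ha hb)
      linarith) (-c)
  have g_le {φ : ∀ k, C(X k × Y, ℝ)} {a : ℝ} (ha : a ∈ dominatingValues μ φ) : g φ ≤ a :=
    (hgN φ).trans (N_le ha)
  have g_nonneg (φ : ∀ k, C(X k × Y, ℝ)) (hφ : ∀ k, 0 ≤ φ k) : 0 ≤ g φ := by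
    have := g_le (φ := -φ) (a := 0) ⟨0, 0, by simp, fun k x y => by
      simpa using hφ k (x, y), by simp⟩
    simpa using this
  let S (k : ι) : C(X k × Y, ℝ) →ₗ[ℝ] (∀ k, C(X k × Y, ℝ)) :=
    LinearMap.single ℝ (fun k => C(X k × Y, ℝ)) k
  choose π hπfin hπ using fun k => ContinuousMap.exists_measure_integral_eq (g ∘ₗ S k)
    (fun φ hφ => g_nonneg _ fun j => by
      by_cases hj : j = k
      · subst hj; simpa [S] using hφ
      · simp [S, hj])
  have hfst (k : ι) : (π k).map Prod.fst = μ k := by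
    refine Measure.eq_of_forall_integral_continuousMap_eq fun v => ?_
    have hle (v : C(X k, ℝ)) : ∫ x, v x ∂((π k).map Prod.fst) ≤ ∫ x, v x ∂(μ k) := by
      rw [integral_map measurable_fst.aemeasurable
        v.continuous.measurable.aestronglyMeasurable]
      refine (hπ k (v.comp ⟨Prod.fst, continuous_fst⟩)).trans_le (g_le ?_)
      refine ⟨Pi.single k v, 0, by simp, fun j x y => ?_, ?_⟩
      · by_cases hj : j = k
        · subst hj; simp [S]
        · simp [S, hj]
      · rw [Finset.sum_eq_single k] <;> simp +contextual
    refine (hle v).antisymm ?_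
    have := hle (-v)
    simpa [integral_neg] using this
  have hsnd (j k : ι) : (π j).map Prod.snd = (π k).map Prod.snd := by
    refine Measure.eq_of_forall_integral_continuousMap_eq fun v => ?_
    have hle (j k : ι) : ∫ y, v y ∂((π j).map Prod.snd) ≤ ∫ y, v y ∂((π k).map Prod.snd) := by
      rw [integral_map measurable_snd.aemeasurable v.continuous.measurable.aestronglyMeasurable,
        integral_map measurable_snd.aemeasurable v.continuous.measurable.aestronglyMeasurable,
        ← sub_nonpos]
      have h1 := hπ j (v.comp ⟨Prod.snd, continuous_snd⟩)
      have h2 := hπ k (v.comp ⟨Prod.snd, continuous_snd⟩)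
      simp only [ContinuousMap.comp_apply, ContinuousMap.coe_mk, LinearMap.comp_apply] at h1 h2
      rw [h1, h2, ← map_sub]
      refine g_le ⟨0, Pi.single j v - Pi.single k v, fun y => ?_, fun i x y => ?_, by simp⟩
      · have hs (i : ι) : ∑ l, (Pi.single i v : ι → C(Y, ℝ)) l y = v y := by
          rw [Finset.sum_eq_single i] <;> simp +contextual
        simp only [Pi.sub_apply, ContinuousMap.sub_apply, Finset.sum_sub_distrib, hs, sub_self]
      · by_cases hj : i = j <;> by_cases hk : i = k <;> subst_vars <;> simp_all [S]
    exact (hle j k).antisymm (hle k j)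
  refine ⟨π, (π (Classical.arbitrary ι)).map Prod.snd, hfst, fun k => hsnd _ _, fun ε hε => ?_⟩
  have hlt : sInf (dominatingValues μ (-c)) < g (-c) + ε := by
    rw [hgc]; exact lt_add_of_pos_right _ hε
  obtain ⟨_, ⟨u, f, hf, h, rfl⟩, hr⟩ := exists_lt_of_csInf_lt (dominatingValues_nonempty μ _) hlt
  refine ⟨-u, -f, fun y => by simp [hf], fun k x y => ?_, ?_⟩
  · have := h k x y
    simp only [Pi.neg_apply, ContinuousMap.neg_apply] at this ⊢
    linarith
  · have hsum : ∑ k, ∫ p, c k p ∂(π k) = g c := by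
      conv_rhs => rw [← LinearMap.sum_single_apply (fun k => C(X k × Y, ℝ)) c, map_sum]
      exact Finset.sum_congr rfl fun k _ => hπ k (c k)
    rw [hsum]
    simp only [Pi.neg_apply, ContinuousMap.neg_apply, integral_neg, Finset.sum_neg_distrib,
      map_neg] at hr ⊢
    linarith

end Duality

lemma ContinuousOn.integrable_comp {Ω E : Type*} [MeasurableSpace Ω] [TopologicalSpace E]
    [T2Space E] [MeasurableSpace E] [OpensMeasurableSpace E] {ν : Measure Ω} [IsFiniteMeasure ν]
    {S : Set E} (hS : IsCompact S) {g : E → ℝ} (hg : ContinuousOn g S) {φ : Ω → E}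
    (hφ : Measurable φ) (h : ∀ᵐ ω ∂ν, φ ω ∈ S) : Integrable (fun ω => g (φ ω)) ν := by
  classical
  obtain ⟨M, hM⟩ := hS.exists_bound_of_continuousOn hg
  have hm : Measurable (S.piecewise g 0) :=
    hg.measurable_piecewise continuousOn_const hS.measurableSet
  refine .of_bound ((hm.comp hφ).aestronglyMeasurable.congr ?_) M ?_
  · filter_upwards [h] with ω hω
    simp [hω]
  · filter_upwards [h] with ω hω using hM _ hω

/-- A measurable choice of `ε`-minimizers of `g (x, ·)` over a compact set. -/
lemma exists_measurable_approx_minimizer {E F : Type*} [TopologicalSpace E] [MeasurableSpace E]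
    [OpensMeasurableSpace E] [TopologicalSpace F] [SecondCountableTopology F] [MeasurableSpace F]
    {Z : Set E} {B : Set F} (hZ : IsClosed Z) (hB : IsCompact B) (hBne : B.Nonempty)
    {g : E × F → ℝ} (hg : ContinuousOn g (Z ×ˢ B)) {ε : ℝ} (hε : 0 < ε) :
    ∃ T : E → F, Measurable T ∧ (∀ x, T x ∈ B) ∧
      ∀ x ∈ Z, ∀ y ∈ B, g (x, T x) ≤ g (x, y) + ε := by
  classical
  have : Nonempty B := hBne.to_subtype
  let s : ℕ → B := TopologicalSpace.denseSeq B
  let p : ℕ → E → Prop := fun n x => x ∈ Z → ∀ y ∈ B, g (x, s n) ≤ g (x, y) + ε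
  have hex (x : E) : ∃ n, p n x := by
    by_cases hx : x ∈ Z
    swap
    · exact ⟨0, fun h => absurd h hx⟩
    have hgx : ContinuousOn (fun y => g (x, y)) B :=
      hg.comp (by fun_prop) fun y hy => ⟨hx, hy⟩
    obtain ⟨y₀, hy₀, hmin⟩ := hB.exists_isMinOn hBne hgx
    obtain ⟨n, hn⟩ := (TopologicalSpace.denseRange_denseSeq B).exists_mem_open
      (isOpen_lt (continuousOn_iff_continuous_domRestrict.1 hgx)
        (continuous_const (y := g (x, y₀) + ε))) ⟨⟨y₀, hy₀⟩, lt_add_of_pos_right _ hε⟩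
    exact ⟨n, fun _ y hy => (le_of_lt hn).trans (by gcongr; exact hmin hy)⟩
  have hp (n : ℕ) : MeasurableSet {x | p n x} := by
    have hslice (y : F) (hy : y ∈ B) : ContinuousOn (fun x => g (x, y)) Z :=
      hg.comp (by fun_prop) fun x hx => ⟨hx, hy⟩
    have hcl : IsClosed (⋂ y : B, {x ∈ Z | g (x, s n) ≤ g (x, y) + ε}) :=
      isClosed_iInter fun y => hZ.isClosed_le (hslice _ (s n).2)
        ((hslice _ y.2).add continuousOn_const)
    convert hZ.measurableSet.compl.union hcl.measurableSet using 1
    ext x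
    by_cases hx : x ∈ Z <;> simp [p, hx]
  refine ⟨fun x => s (Nat.find (hex x)), ?_, fun x => (s _).2, fun x hx =>
    Nat.find_spec (hex x) hx⟩
  exact Measurable.find (f := fun n _ => (s n : F)) (fun _ => measurable_const) hp hex

section OTcost

variable {d d' : ℕ} {Z : Set (Euc d)} {B : Set (Euc d')} {c : Euc d → Euc d' → ℝ}
  {P : Measure (Euc d)} {Q : Measure (Euc d')}

lemma ae_mem_prod_of_map_eq {π : Measure (Euc d × Euc d')} (hfst : π.map Prod.fst = P)
    (hsnd : π.map Prod.snd = Q) (hPZ : ∀ᵐ x ∂P, x ∈ Z) (hQB : ∀ᵐ y ∂Q, y ∈ B) :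
    ∀ᵐ p ∂π, p ∈ Z ×ˢ B := by
  subst hfst hsnd
  filter_upwards [ae_of_ae_map measurable_fst.aemeasurable hPZ,
    ae_of_ae_map measurable_snd.aemeasurable hQB] with p h1 h2 using ⟨h1, h2⟩

lemma integral_coupling_nonneg (hPZ : ∀ᵐ x ∂P, x ∈ Z) (hQB : ∀ᵐ y ∂Q, y ∈ B)
    (hc : ∀ x ∈ Z, ∀ y ∈ B, 0 ≤ c x y) {π : Measure (Euc d × Euc d')}
    (hfst : π.map Prod.fst = P) (hsnd : π.map Prod.snd = Q) : 0 ≤ ∫ p, c p.1 p.2 ∂π :=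
  integral_nonneg_of_ae <| by
    filter_upwards [ae_mem_prod_of_map_eq hfst hsnd hPZ hQB] with p hp using hc _ hp.1 _ hp.2

lemma OTcost_le_integral (hPZ : ∀ᵐ x ∂P, x ∈ Z) (hQB : ∀ᵐ y ∂Q, y ∈ B)
    (hc : ∀ x ∈ Z, ∀ y ∈ B, 0 ≤ c x y) {π : Measure (Euc d × Euc d')} (hπ : IsProbabilityMeasure π)
    (hfst : π.map Prod.fst = P) (hsnd : π.map Prod.snd = Q) :
    OTcost c P Q ≤ ∫ p, c p.1 p.2 ∂π :=
  ciInf_le (f := fun π : {π : Measure (Euc d × Euc d') //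
      IsProbabilityMeasure π ∧ π.map Prod.fst = P ∧ π.map Prod.snd = Q} =>
    ∫ p, c p.1 p.2 ∂(π.1))
    ⟨0, by rintro _ ⟨π, rfl⟩; exact integral_coupling_nonneg hPZ hQB hc π.2.2.1 π.2.2.2⟩
    ⟨π, hπ, hfst, hsnd⟩

lemma OTcost_nonneg (hPZ : ∀ᵐ x ∂P, x ∈ Z) (hQB : ∀ᵐ y ∂Q, y ∈ B)
    (hc : ∀ x ∈ Z, ∀ y ∈ B, 0 ≤ c x y) : 0 ≤ OTcost c P Q :=
  Real.iInf_nonneg fun π => integral_coupling_nonneg hPZ hQB hc π.2.2.1 π.2.2.2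

lemma exists_map_integral_le_OTcost [IsProbabilityMeasure P] [IsProbabilityMeasure Q]
    (hZ : IsCompact Z) (hB : IsCompact B) (hBne : B.Nonempty)
    (hPZ : ∀ᵐ x ∂P, x ∈ Z) (hQB : ∀ᵐ y ∂Q, y ∈ B)
    (hc : ContinuousOn (fun p : Euc d × Euc d' => c p.1 p.2) (Z ×ˢ B))
    {f : Euc d' → ℝ} (hf : ContinuousOn f B) {ε : ℝ} (hε : 0 < ε) :
    ∃ T : Euc d → Euc d', Measurable T ∧ Set.MapsTo T Z B ∧
      ∫ z, (c z (T z) - f (T z)) ∂P ≤ OTcost c P Q - ∫ y, f y ∂Q + ε := by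
  have : Nonempty {π : Measure (Euc d × Euc d') //
      IsProbabilityMeasure π ∧ π.map Prod.fst = P ∧ π.map Prod.snd = Q} :=
    ⟨⟨P.prod Q, inferInstance, by simp, by simp⟩⟩
  obtain ⟨⟨π, hπ, hfst, hsnd⟩, hlt⟩ :=
    exists_lt_of_ciInf_lt (lt_add_of_pos_right (OTcost c P Q) (half_pos hε))
  have hfs : ContinuousOn (fun p : Euc d × Euc d' => f p.2) (Z ×ˢ B) :=
    hf.comp continuousOn_snd fun p hp => hp.2
  obtain ⟨T, hT, hTB, hTmin⟩ := exists_measurable_approx_minimizer hZ.isClosed hB hBne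
    (hc.sub hfs) (half_pos hε)
  refine ⟨T, hT, fun x _ => hTB x, ?_⟩
  have hae := ae_mem_prod_of_map_eq hfst hsnd hPZ hQB
  have hic : Integrable (fun p : Euc d × Euc d' => c p.1 p.2) π :=
    hc.integrable_comp (hZ.prod hB) measurable_id hae
  have hif : Integrable (fun p : Euc d × Euc d' => f p.2) π :=
    hfs.integrable_comp (hZ.prod hB) measurable_id hae
  have hiT : Integrable (fun z => c z (T z) - f (T z)) P :=
    (hc.sub hfs).integrable_comp (hZ.prod hB) (measurable_id.prodMk hT)
      (hPZ.mono fun z hz => ⟨hz, hTB z⟩)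
  have hfQ : Integrable f Q := hf.integrable_comp hB measurable_id hQB
  have h1 : ∫ z, (c z (T z) - f (T z)) ∂P = ∫ p, (c p.1 (T p.1) - f (T p.1)) ∂π := by
    rw [← hfst] at hiT ⊢
    exact integral_map measurable_fst.aemeasurable hiT.aestronglyMeasurable
  have h2 : ∫ y, f y ∂Q = ∫ p, f p.2 ∂π := by
    rw [← hsnd] at hfQ ⊢
    exact integral_map measurable_snd.aemeasurable hfQ.aestronglyMeasurable
  have h3 : ∫ p, (c p.1 (T p.1) - f (T p.1)) ∂π ≤ ∫ p, (c p.1 p.2 - f p.2 + ε / 2) ∂π := by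
    refine integral_mono_ae ?_ ((hic.sub hif).add (integrable_const _)) ?_
    · rw [← hfst] at hiT
      exact hiT.comp_measurable measurable_fst
    · filter_upwards [hae] with p hp using hTmin _ hp.1 _ hp.2
  have h4 : ∫ p, (c p.1 p.2 - f p.2 + ε / 2) ∂π
      = ∫ p, c p.1 p.2 ∂π - ∫ p, f p.2 ∂π + ε / 2 := by
    rw [integral_add (f := fun p : Euc d × Euc d' => c p.1 p.2 - f p.2) (hic.sub hif)
      (integrable_const _), integral_sub hic hif, integral_const, probReal_univ, one_smul]
  simp only at hlt
  linarith

end OTcost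

lemma integral_le_of_forall_le {d d' : ℕ} {Z : Set (Euc d)} {B : Set (Euc d')} (hZ : IsCompact Z)
    (hB : IsCompact B) {P : Measure (Euc d)} [IsFiniteMeasure P] (hPZ : ∀ᵐ x ∂P, x ∈ Z)
    {c : Euc d → Euc d' → ℝ}
    (hc : ContinuousOn (fun p : Euc d × Euc d' => c p.1 p.2) (Z ×ˢ B))
    {f : Euc d' → ℝ} (hf : ContinuousOn f B) {T : Euc d → Euc d'} (hT : Measurable T)
    (hTB : Set.MapsTo T Z B) {u : Euc d → ℝ} (hu : Integrable u P)
    (h : ∀ x ∈ Z, ∀ y ∈ B, u x ≤ c x y - f y) :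
    ∫ z, u z ∂P ≤ ∫ z, (c z (T z) - f (T z)) ∂P := by
  have hfs : ContinuousOn (fun p : Euc d × Euc d' => f p.2) (Z ×ˢ B) :=
    hf.comp continuousOn_snd fun p hp => hp.2
  refine integral_mono_ae hu ?_ (hPZ.mono fun z hz => h z hz _ (hTB hz))
  exact (hc.sub hfs).integrable_comp (hZ.prod hB) (measurable_id.prodMk hT)
    (hPZ.mono fun z hz => ⟨hz, hTB hz⟩)

/-- Strong duality: some probability measure `Q` is, up to `ε`, beaten by potentials summing to
zero. -/
lemma exists_barycenter_approx_potentials {ι : Type*} [Fintype ι] [Nonempty ι] {d : ι → ℕ} {d' : ℕ}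
    {Z : ∀ k, Set (Euc (d k))} (hZ : ∀ k, IsCompact (Z k)) {B : Set (Euc d')} (hB : IsCompact B)
    (hBne : B.Nonempty) {P : ∀ k, Measure (Euc (d k))} [∀ k, IsProbabilityMeasure (P k)]
    (hPZ : ∀ k, ∀ᵐ x ∂(P k), x ∈ Z k) {C : ∀ k, Euc (d k) → Euc d' → ℝ}
    (hC : ∀ k, ContinuousOn (fun p : Euc (d k) × Euc d' => C k p.1 p.2) (Z k ×ˢ B))
    (hC0 : ∀ k, ∀ x ∈ Z k, ∀ y ∈ B, 0 ≤ C k x y) {lam : ι → ℝ} (hlam : ∀ k, 0 < lam k) :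
    ∃ Q : Measure (Euc d'), IsProbabilityMeasure Q ∧ Q B = 1 ∧ ∀ ε > 0,
      ∃ f : ι → Euc d' → ℝ, (∀ k, ContinuousOn (f k) B) ∧ (∀ y ∈ B, ∑ k, lam k * f k y = 0) ∧
        ∀ T : ∀ k, Euc (d k) → Euc d', (∀ k, Measurable (T k) ∧ Set.MapsTo (T k) (Z k) B) →
          ∑ k, lam k * OTcost (C k) (P k) Q
            ≤ ∑ k, lam k * ∫ z, (C k z (T k z) - f k (T k z)) ∂(P k) + ε := by
  have (k : ι) : CompactSpace (Z k) := isCompact_iff_compactSpace.1 (hZ k)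
  have : CompactSpace B := isCompact_iff_compactSpace.1 hB
  have : Nonempty B := hBne.to_subtype
  have hZm (k : ι) : MeasurableSet (Z k) := (hZ k).measurableSet
  let μ (k : ι) : Measure (Z k) := (P k).comap Subtype.val
  have hμ (k : ι) : (μ k).map Subtype.val = P k := by
    rw [map_comap_subtype_coe (hZm k), Measure.restrict_eq_self_of_ae_mem (hPZ k)]
  have (k : ι) : IsProbabilityMeasure (μ k) := by
    have : IsProbabilityMeasure ((μ k).map Subtype.val) := by rw [hμ]; infer_instance
    exact Measure.isProbabilityMeasure_of_map Subtype.val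
  let c (k : ι) : C(Z k × B, ℝ) :=
    ⟨fun p => lam k * C k p.1 p.2, continuous_const.mul ((hC k).comp_continuous
      (f := fun p : Z k × B => ((p.1 : Euc (d k)), (p.2 : Euc d'))) (by fun_prop)
        fun p => ⟨p.1.2, p.2.2⟩)⟩
  obtain ⟨π, ν, hfst, hsnd, hdual⟩ := exists_plans_common_marginal μ c
  have hπ (k : ι) : IsProbabilityMeasure (π k) := by
    have : IsProbabilityMeasure ((π k).map Prod.fst) := by rw [hfst]; infer_instance
    exact Measure.isProbabilityMeasure_of_map Prod.fst
  have hν : IsProbabilityMeasure ν := by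
    rw [← hsnd (Classical.arbitrary ι)]
    exact Measure.isProbabilityMeasure_map measurable_snd.aemeasurable
  have hQ : IsProbabilityMeasure (ν.map Subtype.val) :=
    Measure.isProbabilityMeasure_map measurable_subtype_coe.aemeasurable
  have hQB : ν.map Subtype.val B = 1 := by
    rw [Measure.map_apply measurable_subtype_coe hB.measurableSet]
    simp
  have hOT (k : ι) : lam k * OTcost (C k) (P k) (ν.map Subtype.val) ≤ ∫ p, c k p ∂(π k) := by
    let j : Z k × B → Euc (d k) × Euc d' := Prod.map Subtype.val Subtype.val
    have hj : MeasurableEmbedding j :=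
      (MeasurableEmbedding.subtype_coe (hZm k)).prodMap
        (MeasurableEmbedding.subtype_coe hB.measurableSet)
    have h := OTcost_le_integral (hPZ k) ((prob_compl_eq_zero_iff hB.measurableSet).2 hQB) (hC0 k)
      (π := (π k).map j) (Measure.isProbabilityMeasure_map hj.measurable.aemeasurable)
      (by rw [Measure.map_map measurable_fst hj.measurable, ← hμ k, ← hfst k,
            Measure.map_map measurable_subtype_coe measurable_fst]; rfl)
      (by rw [Measure.map_map measurable_snd hj.measurable, ← hsnd k,
            Measure.map_map measurable_subtype_coe measurable_snd]; rfl)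
    rw [hj.integral_map] at h
    calc _ ≤ lam k * ∫ p, C k (j p).1 (j p).2 ∂(π k) := mul_le_mul_of_nonneg_left h (hlam k).le
      _ = _ := (integral_const_mul _ _).symm
  refine ⟨_, hQ, hQB, fun ε hε => ?_⟩
  obtain ⟨u, f, hf, huf, hlt⟩ := hdual ε hε
  let F (k : ι) : Euc d' → ℝ := Function.extend Subtype.val (fun y => f k y / lam k) 0
  let U (k : ι) : Euc (d k) → ℝ := Function.extend Subtype.val (fun x => u k x / lam k) 0
  have hF (k : ι) (y : B) : F k y = f k y / lam k := Subtype.val_injective.extend_apply ..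
  have hU (k : ι) (x : Z k) : U k x = u k x / lam k := Subtype.val_injective.extend_apply ..
  have hFc (k : ι) : ContinuousOn (F k) B := by
    rw [continuousOn_iff_continuous_domRestrict]
    exact ((f k).continuous.div_const (lam k)).congr fun y => (hF k y).symm
  refine ⟨F, hFc, fun y hy => ?_, fun T hT => ?_⟩
  · rw [← hf ⟨y, hy⟩]
    refine Finset.sum_congr rfl fun k _ => ?_
    rw [hF k ⟨y, hy⟩, mul_div_cancel₀ _ (hlam k).ne']
  calc ∑ k, lam k * OTcost (C k) (P k) (ν.map Subtype.val)
      ≤ ∑ k, ∫ p, c k p ∂(π k) := Finset.sum_le_sum fun k _ => hOT k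
    _ ≤ ∑ k, ∫ x, u k x ∂(μ k) + ε := hlt.le
    _ ≤ _ := by
      gcongr with k
      have he : MeasurableEmbedding (Subtype.val : Z k → Euc (d k)) := .subtype_coe (hZm k)
      have hUi : Integrable (U k) (P k) := by
        rw [← hμ k, he.integrable_map_iff]
        exact (((u k).integrable_of_compactSpace _).div_const (lam k)).congr
          (ae_of_all _ fun x => (hU k x).symm)
      have hUint : ∫ x, u k x ∂(μ k) = lam k * ∫ z, U k z ∂(P k) := by
        rw [← hμ k, he.integral_map, ← integral_const_mul]
        refine integral_congr_ae (ae_of_all _ fun x => ?_)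
        simp only [hU, mul_div_cancel₀ _ (hlam k).ne']
      rw [hUint]
      refine mul_le_mul_of_nonneg_left (integral_le_of_forall_le (hZ k) hB (hPZ k) (hC k) (hFc k)
        (hT k).1 (hT k).2 hUi fun x hx y hy => ?_) (hlam k).le
      have h := huf k ⟨x, hx⟩ ⟨y, hy⟩
      rw [hU k ⟨x, hx⟩, hF k ⟨y, hy⟩, le_sub_iff_add_le, ← add_div, div_le_iff₀' (hlam k)]
      exact h

/-- **Maximin reformulation of the barycenter problem (Eq. (8)).**
ℒ* = sup_{Σ_k λ_k f_k ≡ 0} inf_{T_{1:K} Borel} F(f_{1:K}, T_{1:K}), where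
F(f_{1:K}, T_{1:K}) = Σ_k λ_k ∫ [C_k(z, T_k(z)) − f_k(T_k(z))] dℙ_k(z). -/
theorem barycenter_maximin
    (K : ℕ) (hK : 0 < K) (d : Fin K → ℕ) (d' : ℕ)
    (Z : ∀ k : Fin K, Set (Euc (d k))) (hZc : ∀ k, IsCompact (Z k))
    (hZne : ∀ k, (Z k).Nonempty)
    (ZB : Set (Euc d')) (hZBc : IsCompact ZB) (hZBne : ZB.Nonempty)
    (P : ∀ k : Fin K, Measure (Euc (d k))) (hPprob : ∀ k, IsProbabilityMeasure (P k))
    (hPsupp : ∀ k, P k (Z k) = 1)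
    (C : ∀ k : Fin K, Euc (d k) → Euc d' → ℝ)
    (hCcont : ∀ k, ContinuousOn (fun p : Euc (d k) × Euc d' => C k p.1 p.2) (Z k ×ˢ ZB))
    (hCnonneg : ∀ k, ∀ x ∈ Z k, ∀ y ∈ ZB, 0 ≤ C k x y)
    (lam : Fin K → ℝ) (hlam : ∀ k, 0 < lam k) (hlamsum : ∑ k, lam k = 1) :
    (⨅ Q : {Q : Measure (Euc d') // IsProbabilityMeasure Q ∧ Q ZB = 1},
        ∑ k, lam k * OTcost (C k) (P k) Q.1)
      = ⨆ f : {f : ∀ k : Fin K, Euc d' → ℝ //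
            (∀ k, ContinuousOn (f k) ZB) ∧ ∀ y ∈ ZB, ∑ k, lam k * f k y = 0},
          ⨅ T : {T : ∀ k : Fin K, Euc (d k) → Euc d' //
              ∀ k, Measurable (T k) ∧ Set.MapsTo (T k) (Z k) ZB},
            ∑ k, lam k * ∫ z, (C k z (T.1 k z) - f.1 k (T.1 k z)) ∂(P k) := by
  have : Nonempty (Fin K) := ⟨⟨0, hK⟩⟩
  have hPZ (k : Fin K) : ∀ᵐ x ∂(P k), x ∈ Z k :=
    (prob_compl_eq_zero_iff (hZc k).measurableSet).2 (hPsupp k)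
  let IsPot : (∀ _ : Fin K, Euc d' → ℝ) → Prop := fun f =>
    (∀ k, ContinuousOn (f k) ZB) ∧ ∀ y ∈ ZB, ∑ k, lam k * f k y = 0
  let V : (∀ _ : Fin K, Euc d' → ℝ) → (∀ k : Fin K, Euc (d k) → Euc d') → ℝ := fun f T =>
    ∑ k, lam k * ∫ z, (C k z (T k z) - f k (T k z)) ∂(P k)
  have hVbdd (f : {f // IsPot f}) : BddBelow (Set.range fun T : {T : ∀ k, Euc (d k) → Euc d' //
      ∀ k, Measurable (T k) ∧ Set.MapsTo (T k) (Z k) ZB} => V f.1 T.1) := by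
    choose M hM using fun k => hZBc.exists_bound_of_continuousOn (f.2.1 k)
    refine ⟨∑ k, lam k * ∫ _, -M k ∂(P k), ?_⟩
    rintro _ ⟨T, rfl⟩
    refine Finset.sum_le_sum fun k _ => mul_le_mul_of_nonneg_left ?_ (hlam k).le
    refine integral_le_of_forall_le (hZc k) hZBc (hPZ k) (hCcont k) (f.2.1 k) (T.2 k).1 (T.2 k).2
      (integrable_const _) fun x hx y hy => ?_
    linarith [hCnonneg k x hx y hy, (le_abs_self _).trans (hM k y hy)]
  have hweak (f : {f // IsPot f}) (Q : Measure (Euc d')) (hQ : IsProbabilityMeasure Q)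
      (hQB : Q ZB = 1) :
      (⨅ T : {T : ∀ k, Euc (d k) → Euc d' //
        ∀ k, Measurable (T k) ∧ Set.MapsTo (T k) (Z k) ZB}, V f.1 T.1)
        ≤ ∑ k, lam k * OTcost (C k) (P k) Q := by
    have hQB' : ∀ᵐ y ∂Q, y ∈ ZB := (prob_compl_eq_zero_iff hZBc.measurableSet).2 hQB
    refine le_of_forall_pos_le_add fun ε hε => ?_
    choose T hT hTB hTle using fun k => exists_map_integral_le_OTcost (hZc k) hZBc hZBne (hPZ k)
      hQB' (hCcont k) (f.2.1 k) hε
    refine (ciInf_le (hVbdd f) ⟨T, fun k => ⟨hT k, hTB k⟩⟩).trans ?_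
    have hzero : ∑ k, lam k * ∫ y, f.1 k y ∂Q = 0 := by
      simp_rw [← integral_const_mul]
      have hi (k : Fin K) : Integrable (f.1 k) Q :=
        (f.2.1 k).integrable_comp hZBc measurable_id hQB'
      rw [← integral_finsetSum _ fun k _ => (hi k).const_mul (lam k)]
      exact integral_eq_zero_of_ae (hQB'.mono fun y hy => f.2.2 y hy)
    calc V f.1 T ≤ ∑ k, lam k * (OTcost (C k) (P k) Q - ∫ y, f.1 k y ∂Q + ε) :=
          Finset.sum_le_sum fun k _ => mul_le_mul_of_nonneg_left (hTle k) (hlam k).le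
      _ = _ := by
        simp only [mul_add, mul_sub, Finset.sum_add_distrib, Finset.sum_sub_distrib, hzero,
          ← Finset.sum_mul, hlamsum]
        ring
  have : Nonempty {f // IsPot f} := ⟨0, fun _ => continuousOn_const, by simp⟩
  obtain ⟨y₀, hy₀⟩ := hZBne
  have : Nonempty {T : ∀ k, Euc (d k) → Euc d' //
      ∀ k, Measurable (T k) ∧ Set.MapsTo (T k) (Z k) ZB} :=
    ⟨fun _ _ => y₀, fun _ => ⟨measurable_const, fun _ _ => hy₀⟩⟩
  obtain ⟨Q, hQ, hQB, hstrong⟩ := exists_barycenter_approx_potentials hZc hZBc ⟨y₀, hy₀⟩ hPZ hCcont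
    hCnonneg hlam
  have : Nonempty {Q : Measure (Euc d') // IsProbabilityMeasure Q ∧ Q ZB = 1} := ⟨Q, hQ, hQB⟩
  refine le_antisymm ?_ (ciSup_le fun f => le_ciInf fun Q => hweak f Q.1 Q.2.1 Q.2.2)
  refine (ciInf_le ⟨0, ?_⟩ ⟨Q, hQ, hQB⟩).trans ?_
  · rintro _ ⟨Q, rfl⟩
    have := Q.2.1
    exact Finset.sum_nonneg fun k _ => mul_nonneg (hlam k).le (OTcost_nonneg (hPZ k)
      ((prob_compl_eq_zero_iff hZBc.measurableSet).2 Q.2.2) (hCnonneg k))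
  refine le_of_forall_pos_le_add fun ε hε => ?_
  obtain ⟨f, hf, hf0, hfT⟩ := hstrong ε hε
  have hle := le_ciSup (f := fun f : {f // IsPot f} =>
    ⨅ T : {T : ∀ k, Euc (d k) → Euc d' //
      ∀ k, Measurable (T k) ∧ Set.MapsTo (T k) (Z k) ZB}, V f.1 T.1)
    ⟨_, by rintro _ ⟨f, rfl⟩; exact hweak f Q hQ hQB⟩ ⟨f, hf, hf0⟩
  refine sub_le_iff_le_add.1 (le_trans ?_ hle)
  exact le_ciInf fun T => sub_le_iff_le_add.2 (hfT T.1 T.2)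
end

section
/- Interchange of infimum and integral (Rockafellar-type interchange used to pass from Eq. (6) to Eq. (7)): for a probability measure ℙ on a compact set 𝒳 ⊆ ℝ^d, a continuous cost c : 𝒳 × 𝒴 → [0,∞) with 𝒴 ⊆ ℝ^{d'} compact, and a continuous function f on 𝒴, one has ∫_𝒳 f^c(x) dℙ(x) = inf_{T} ∫_𝒳 [c(x, T(x)) − f(T(x))] dℙ(x), where the infimum is taken over all Borel measurable maps T : 𝒳 → 𝒴. -/
open MeasureTheory

/-- The infimum of a continuous function over a space is its infimum along a dense sequence. -/
theorem ciInf_eq_ciInf_of_denseRange {α : Type*} [TopologicalSpace α] [Nonempty α]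
    {u : ℕ → α} (hu : DenseRange u) {g : α → ℝ} (hg : Continuous g)
    (hb : BddBelow (Set.range g)) : ⨅ y, g y = ⨅ n, g (u n) := by
  have hb' : BddBelow (Set.range fun n => g (u n)) :=
    hb.mono (Set.range_comp_subset_range u g)
  refine le_antisymm (le_ciInf fun n => ciInf_le hb (u n)) (le_ciInf fun y => ?_)
  exact hu.induction_on (p := fun y => ⨅ n, g (u n) ≤ g y) y
    (isClosed_le continuous_const hg) fun n => ciInf_le hb' n

/-- Measurable `ε`-optimal selection from a sequence of points. -/
theorem exists_measurable_lt_iInf_add {α β : Type*} [MeasurableSpace α] [MeasurableSpace β]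
    {H : α × β → ℝ} (hH : Measurable H) (u : ℕ → β)
    (hG : Measurable fun x => ⨅ n, H (x, u n)) {ε : ℝ} (hε : 0 < ε) :
    ∃ T : α → β, Measurable T ∧ (∀ x, T x ∈ Set.range u) ∧
      ∀ x, H (x, T x) < (⨅ n, H (x, u n)) + ε := by
  classical
  have hex : ∀ x, ∃ n, H (x, u n) < (⨅ n, H (x, u n)) + ε := fun x =>
    exists_lt_of_ciInf_lt (lt_add_of_pos_right _ hε)
  refine ⟨fun x => u (Nat.find (hex x)), ?_, fun x => ⟨_, rfl⟩, fun x => Nat.find_spec (hex x)⟩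
  exact (measurable_from_nat (f := u)).comp (measurable_find hex fun n =>
    measurableSet_lt (hH.comp (measurable_id.prodMk measurable_const)) (hG.add_const ε))

/-- **Interchange of infimum and integral (Rockafellar-type interchange).**
∫_𝒳 f^c(x) dℙ(x) = inf_T ∫_𝒳 [c(x, T(x)) − f(T(x))] dℙ(x), the infimum being over
all Borel measurable maps T : 𝒳 → 𝒴. -/
theorem interchange_inf_integral
    {d d' : ℕ} (X : Set (Euc d)) (Y : Set (Euc d'))
    (hX : IsCompact X) (hY : IsCompact Y) (hXne : X.Nonempty) (hYne : Y.Nonempty)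
    (P : Measure (Euc d)) (hP : IsProbabilityMeasure P) (hPsupp : P X = 1)
    (c : Euc d → Euc d' → ℝ)
    (hc : ContinuousOn (fun p : Euc d × Euc d' => c p.1 p.2) (X ×ˢ Y))
    (hc0 : ∀ x ∈ X, ∀ y ∈ Y, 0 ≤ c x y)
    (f : Euc d' → ℝ) (hf : ContinuousOn f Y) :
    (∫ x, ctrans Y c f x ∂P)
      = ⨅ T : {T : Euc d → Euc d' // Measurable T ∧ Set.MapsTo T X Y},
          ∫ x, (c x (T.1 x) - f (T.1 x)) ∂P := by
  classical
  have : Nonempty Y := hYne.to_subtype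
  have hh : ContinuousOn (fun p : Euc d × Euc d' => c p.1 p.2 - f p.2) (X ×ˢ Y) :=
    hc.sub (hf.comp continuousOn_snd fun p hp => hp.2)
  obtain ⟨C, hC⟩ := (hX.prod hY).exists_bound_of_continuousOn hh
  have hC0 : 0 ≤ C := by
    obtain ⟨x, hx⟩ := hXne
    obtain ⟨y, hy⟩ := hYne
    exact (norm_nonneg _).trans (hC (x, y) ⟨hx, hy⟩)
  set H : Euc d × Euc d' → ℝ :=
    (X ×ˢ Y).piecewise (fun p => c p.1 p.2 - f p.2) (fun _ => 0) with hHdef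
  have hHm : Measurable H := hh.measurable_piecewise continuousOn_const
    (hX.measurableSet.prod hY.measurableSet)
  have hHeq : ∀ x ∈ X, ∀ y ∈ Y, H (x, y) = c x y - f y := fun x hx y hy =>
    Set.piecewise_eq_of_mem _ _ _ (show (x, y) ∈ X ×ˢ Y from ⟨hx, hy⟩)
  have hHb : ∀ p, ‖H p‖ ≤ C := fun p => by
    by_cases hp : p ∈ X ×ˢ Y
    · rw [hHdef, Set.piecewise_eq_of_mem _ _ _ hp]
      exact hC p hp
    · rw [hHdef, Set.piecewise_eq_of_notMem _ _ _ hp, norm_zero]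
      exact hC0
  have hHlb : ∀ p, -C ≤ H p := fun p => (abs_le.1 (hHb p)).1
  have haeX : ∀ᵐ x ∂P, x ∈ X := (mem_ae_iff_prob_eq_one hX.measurableSet).2 hPsupp
  set u : ℕ → Euc d' := fun n => (TopologicalSpace.denseSeq Y n : Euc d')
  have huY : ∀ n, u n ∈ Y := fun n => (TopologicalSpace.denseSeq Y n).2
  have hbdd : ∀ x, BddBelow (Set.range fun n => H (x, u n)) := fun x =>
    ⟨-C, by rintro _ ⟨n, rfl⟩; exact hHlb _⟩
  have hGm : Measurable fun x => ⨅ n, H (x, u n) :=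
    Measurable.iInf fun n => hHm.comp (measurable_id.prodMk measurable_const)
  have hGi : Integrable (fun x => ⨅ n, H (x, u n)) P :=
    Integrable.of_bound hGm.aestronglyMeasurable C <| ae_of_all _ fun x =>
      abs_le.2 ⟨le_ciInf fun n => hHlb _,
        (ciInf_le (hbdd x) 0).trans (abs_le.1 (hHb _)).2⟩
  have hctb : ∀ x ∈ X, BddBelow (Set.range fun y : Y => c x y - f y) := fun x hx =>
    ⟨-C, by rintro _ ⟨y, rfl⟩; exact (abs_le.1 (hC (x, y) ⟨hx, y.2⟩)).1⟩
  have hct : ∀ x ∈ X, ctrans Y c f x = ⨅ n, H (x, u n) := fun x hx => by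
    have hcont : Continuous fun y : Y => c x y - f y :=
      hh.comp_continuous (f := fun y : Y => (x, (y : Euc d'))) (by fun_prop)
        fun y => ⟨hx, y.2⟩
    rw [ctrans, ciInf_eq_ciInf_of_denseRange (TopologicalSpace.denseRange_denseSeq Y) hcont
      (hctb x hx)]
    exact iInf_congr fun n => (hHeq x hx _ (huY n)).symm
  have hTi : ∀ T : Euc d → Euc d', Measurable T → Integrable (fun x => H (x, T x)) P :=
    fun T hT => Integrable.of_bound (hHm.comp (measurable_id.prodMk hT)).aestronglyMeasurable C <|
      ae_of_all _ fun x => hHb _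
  have hTeq : ∀ T : Euc d → Euc d', Set.MapsTo T X Y →
      ∫ x, (c x (T x) - f (T x)) ∂P = ∫ x, H (x, T x) ∂P := fun T hT =>
    integral_congr_ae (haeX.mono fun x hx => (hHeq x hx _ (hT hx)).symm)
  have hle : ∀ T : {T : Euc d → Euc d' // Measurable T ∧ Set.MapsTo T X Y},
      ∫ x, (⨅ n, H (x, u n)) ∂P ≤ ∫ x, (c x (T.1 x) - f (T.1 x)) ∂P := fun T => by
    rw [hTeq T.1 T.2.2]
    refine integral_mono_ae hGi (hTi T.1 T.2.1) (haeX.mono fun x hx => ?_)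
    change (⨅ n, H (x, u n)) ≤ H (x, T.1 x)
    rw [← hct x hx, hHeq x hx _ (T.2.2 hx)]
    exact ciInf_le (hctb x hx) ⟨T.1 x, T.2.2 hx⟩
  have : Nonempty {T : Euc d → Euc d' // Measurable T ∧ Set.MapsTo T X Y} :=
    ⟨fun _ => u 0, measurable_const, fun _ _ => huY 0⟩
  rw [integral_congr_ae (haeX.mono hct)]
  refine le_antisymm (le_ciInf hle) (le_of_forall_pos_le_add fun ε hε => ?_)
  obtain ⟨T, hTm, hTu, hTlt⟩ := exists_measurable_lt_iInf_add hHm u hGm hε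
  have hTY : Set.MapsTo T X Y := fun x _ => by
    obtain ⟨n, hn⟩ := hTu x
    exact hn ▸ huY n
  calc _ ≤ ∫ x, (c x (T x) - f (T x)) ∂P :=
        ciInf_le ⟨_, Set.forall_mem_range.2 hle⟩ ⟨T, hTm, hTY⟩
    _ = ∫ x, H (x, T x) ∂P := hTeq T hTY
    _ ≤ ∫ x, ((⨅ n, H (x, u n)) + ε) ∂P :=
        integral_mono (hTi T hTm) (hGi.add (integrable_const ε)) fun x => (hTlt x).le
    _ = (∫ x, (⨅ n, H (x, u n)) ∂P) + ε := by
        rw [integral_add hGi (integrable_const ε)]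
        simp
end

section
/- Existence of the OT barycenter: the infimum defining ℒ* is attained, i.e., there exists a probability measure ℚ* on 𝒵_B such that Σ_{k=1}^K λ_k OT_{C_k}(ℙ_k, ℚ*) = ℒ* = inf_{ℚ ∈ 𝒫(𝒵_B)} Σ_{k=1}^K λ_k OT_{C_k}(ℙ_k, ℚ). -/
open MeasureTheory

open Set

lemma MeasurableEmbedding.exists_probabilityMeasure_map_eq {α β : Type*} [MeasurableSpace α]
    [MeasurableSpace β] {e : α → β} (he : MeasurableEmbedding e) (μ : Measure β)
    [IsProbabilityMeasure μ] (hμ : μ (range e) = 1) :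
    ∃ ν : ProbabilityMeasure α, (ν : Measure α).map e = μ := by
  have hmap : (μ.comap e).map e = μ := by
    rw [he.map_comap]
    exact Measure.restrict_eq_self_of_ae_mem
      ((prob_compl_eq_zero_iff he.measurableSet_range).2 hμ)
  have : IsProbabilityMeasure (μ.comap e) := ⟨by
    rw [he.comap_apply, image_univ, hμ]⟩
  exact ⟨⟨μ.comap e, this⟩, hmap⟩

/-- The set of transport plans over which `OTcost` takes its infimum. -/
abbrev Coupling {d d' : ℕ} (P : Measure (Euc d)) (Q : Measure (Euc d')) :=
  {π : Measure (Euc d × Euc d') //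
    IsProbabilityMeasure π ∧ π.map Prod.fst = P ∧ π.map Prod.snd = Q}

section Support

variable {d d' : ℕ} {Z : Set (Euc d)} {ZB : Set (Euc d')}

/-- The inclusion of `Z × ZB` into the ambient product. -/
def prodIncl (Z : Set (Euc d)) (ZB : Set (Euc d')) : Z × ZB → Euc d × Euc d' :=
  Prod.map Subtype.val Subtype.val

lemma measurableEmbedding_prodIncl (hZ : MeasurableSet Z) (hZB : MeasurableSet ZB) :
    MeasurableEmbedding (prodIncl Z ZB) :=
  (MeasurableEmbedding.subtype_coe hZ).prodMap (MeasurableEmbedding.subtype_coe hZB)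

lemma Coupling.exists_map_prodIncl_eq (hZ : MeasurableSet Z) (hZB : MeasurableSet ZB)
    {P : Measure (Euc d)} {Q : Measure (Euc d')} (hP : P Z = 1) (hQ : Q ZB = 1)
    (π : Coupling P Q) :
    ∃ ν : ProbabilityMeasure (Z × ZB), (ν : Measure (Z × ZB)).map (prodIncl Z ZB) = π.1 := by
  obtain ⟨π, hπ, h₁, h₂⟩ := π
  refine (measurableEmbedding_prodIncl hZ hZB).exists_probabilityMeasure_map_eq π ?_
  have hrange : range (prodIncl Z ZB) = Prod.fst ⁻¹' Z ∩ Prod.snd ⁻¹' ZB := by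
    rw [prodIncl, range_prodMap, Subtype.range_coe, Subtype.range_coe, prod_eq]
  have hfst : ∀ᵐ p ∂π, p.1 ∈ Z := by
    refine (mem_ae_iff_prob_eq_one (measurable_fst hZ)).2 ?_
    rw [← Measure.map_apply measurable_fst hZ, h₁, hP]
  have hsnd : ∀ᵐ p ∂π, p.2 ∈ ZB := by
    refine (mem_ae_iff_prob_eq_one (measurable_snd hZB)).2 ?_
    rw [← Measure.map_apply measurable_snd hZB, h₂, hQ]
  rw [hrange, ← mem_ae_iff_prob_eq_one ((measurable_fst hZ).inter (measurable_snd hZB))]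
  exact hfst.and hsnd

instance {P : Measure (Euc d)} {Q : Measure (Euc d')} [IsProbabilityMeasure P]
    [IsProbabilityMeasure Q] : Nonempty (Coupling P Q) :=
  ⟨⟨P.prod Q, inferInstance, by simp [Measure.map_fst_prod], by simp [Measure.map_snd_prod]⟩⟩

lemma Coupling.integral_nonneg (hZ : MeasurableSet Z) (hZB : MeasurableSet ZB)
    {P : Measure (Euc d)} {Q : Measure (Euc d')} (hP : P Z = 1) (hQ : Q ZB = 1)
    {c : Euc d → Euc d' → ℝ} (hc : ∀ x ∈ Z, ∀ y ∈ ZB, 0 ≤ c x y) (π : Coupling P Q) :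
    0 ≤ ∫ p, c p.1 p.2 ∂π.1 := by
  obtain ⟨ν, hν⟩ := π.exists_map_prodIncl_eq hZ hZB hP hQ
  rw [← hν, (measurableEmbedding_prodIncl hZ hZB).integral_map]
  exact MeasureTheory.integral_nonneg fun p => hc _ p.1.2 _ p.2.2

lemma OTcost_le_integral_s7 (hZ : MeasurableSet Z) (hZB : MeasurableSet ZB)
    {P : Measure (Euc d)} {Q : Measure (Euc d')} (hP : P Z = 1) (hQ : Q ZB = 1)
    {c : Euc d → Euc d' → ℝ} (hc : ∀ x ∈ Z, ∀ y ∈ ZB, 0 ≤ c x y) (π : Coupling P Q) :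
    OTcost c P Q ≤ ∫ p, c p.1 p.2 ∂π.1 := by
  refine ciInf_le ⟨0, ?_⟩ π
  rintro _ ⟨π, rfl⟩
  exact Coupling.integral_nonneg hZ hZB hP hQ hc π

end Support

/-- Families of transport plans from the `P k` to one common second marginal. -/
def jointPlans {ι : Type*} {d : ι → ℕ} {d' : ℕ} (Z : ∀ k, Set (Euc (d k))) (ZB : Set (Euc d'))
    (P : ∀ k, ProbabilityMeasure (Euc (d k))) : Set (∀ k, ProbabilityMeasure (Z k × ZB)) :=
  {ν | (∀ k, (ν k).map (f := fun p => (p.1 : Euc (d k))) (by fun_prop) = P k) ∧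
    ∀ j k, (ν j).map (f := Prod.snd) (by fun_prop) = (ν k).map (f := Prod.snd) (by fun_prop)}

lemma isClosed_jointPlans {ι : Type*} {d : ι → ℕ} {d' : ℕ} (Z : ∀ k, Set (Euc (d k)))
    (ZB : Set (Euc d')) (P : ∀ k, ProbabilityMeasure (Euc (d k))) :
    IsClosed (jointPlans Z ZB P) := by
  simp only [jointPlans, ofPred_and, ofPred_forall]
  refine (isClosed_iInter fun k => ?_).inter
    (isClosed_iInter fun j => isClosed_iInter fun k => ?_)
  · exact isClosed_eq ((ProbabilityMeasure.continuous_map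
      (by fun_prop : Continuous fun p : Z k × ZB => (p.1 : Euc (d k)))).comp
        (continuous_apply k)) continuous_const
  · exact isClosed_eq
      ((ProbabilityMeasure.continuous_map continuous_snd).comp (continuous_apply j))
      ((ProbabilityMeasure.continuous_map continuous_snd).comp (continuous_apply k))

/-- Couplings of the `P k` with a common `Q` supported in `ZB` come from `jointPlans`. -/
lemma exists_mem_jointPlans {ι : Type*} {d : ι → ℕ} {d' : ℕ} {Z : ∀ k, Set (Euc (d k))}
    {ZB : Set (Euc d')} (hZ : ∀ k, MeasurableSet (Z k)) (hZB : MeasurableSet ZB)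
    (P : ∀ k, ProbabilityMeasure (Euc (d k))) (hP : ∀ k, (P k : Measure (Euc (d k))) (Z k) = 1)
    {Q : Measure (Euc d')} (hQ : Q ZB = 1)
    (π : ∀ k, Coupling (P k : Measure (Euc (d k))) Q) :
    ∃ ν ∈ jointPlans Z ZB P,
      ∀ k, (ν k : Measure (Z k × ZB)).map (prodIncl (Z k) ZB) = (π k).1 := by
  choose ν hν using fun k => (π k).exists_map_prodIncl_eq (hZ k) hZB (hP k) hQ
  have hincl k := (measurableEmbedding_prodIncl (hZ k) hZB).measurable
  refine ⟨ν, ⟨fun k => Subtype.ext ?_, fun j k => Subtype.ext ?_⟩, hν⟩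
  · have h := (π k).2.2.1
    rwa [← hν k, Measure.map_map measurable_fst (hincl k)] at h
  · have h k : ((ν k : Measure (Z k × ZB)).map Prod.snd).map Subtype.val = Q := by
      have h := (π k).2.2.2
      rw [← hν k, Measure.map_map measurable_snd (hincl k)] at h
      rwa [Measure.map_map measurable_subtype_coe measurable_snd]
    refine Measure.ext fun s hs => ?_
    have hval := MeasurableEmbedding.subtype_coe hZB
    have hs' : (Subtype.val ⁻¹' (Subtype.val '' s) : Set ZB) = s :=
      preimage_image_eq s Subtype.val_injective
    have key := congrArg (fun μ => μ (Subtype.val '' s)) ((h j).trans (h k).symm)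
    simp only [hval.map_apply, hs'] at key
    exact key

/-- **Existence of the OT barycenter.** The infimum defining ℒ* is attained: there
exists a probability measure ℚ* on 𝒵_B with
Σ_k λ_k OT_{C_k}(ℙ_k, ℚ*) = ℒ* = inf_ℚ Σ_k λ_k OT_{C_k}(ℙ_k, ℚ). -/
theorem barycenter_exists
    (K : ℕ) (hK : 0 < K) (d : Fin K → ℕ) (d' : ℕ)
    (Z : ∀ k : Fin K, Set (Euc (d k))) (hZc : ∀ k, IsCompact (Z k))
    (hZne : ∀ k, (Z k).Nonempty)
    (ZB : Set (Euc d')) (hZBc : IsCompact ZB) (hZBne : ZB.Nonempty)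
    (P : ∀ k : Fin K, Measure (Euc (d k))) (hPprob : ∀ k, IsProbabilityMeasure (P k))
    (hPsupp : ∀ k, P k (Z k) = 1)
    (C : ∀ k : Fin K, Euc (d k) → Euc d' → ℝ)
    (hCcont : ∀ k, ContinuousOn (fun p : Euc (d k) × Euc d' => C k p.1 p.2) (Z k ×ˢ ZB))
    (hCnonneg : ∀ k, ∀ x ∈ Z k, ∀ y ∈ ZB, 0 ≤ C k x y)
    (lam : Fin K → ℝ) (hlam : ∀ k, 0 < lam k) (hlamsum : ∑ k, lam k = 1) :
    ∃ Qstar : Measure (Euc d'), IsProbabilityMeasure Qstar ∧ Qstar ZB = 1 ∧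
      (∑ k, lam k * OTcost (C k) (P k) Qstar)
        = ⨅ Q : {Q : Measure (Euc d') // IsProbabilityMeasure Q ∧ Q ZB = 1},
            ∑ k, lam k * OTcost (C k) (P k) Q.1 := by
  have hZ k : MeasurableSet (Z k) := (hZc k).measurableSet
  have hZB : MeasurableSet ZB := hZBc.measurableSet
  have hcompact k : CompactSpace (Z k) := isCompact_iff_compactSpace.1 (hZc k)
  have hcompactB : CompactSpace ZB := isCompact_iff_compactSpace.1 hZBc
  let P' k : ProbabilityMeasure (Euc (d k)) := ⟨P k, hPprob k⟩
  let J (ν : ∀ k, ProbabilityMeasure (Z k × ZB)) : ℝ :=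
    ∑ k, lam k * ∫ p, C k p.1 p.2 ∂(ν k : Measure (Z k × ZB))
  have hcont k : Continuous fun p : Z k × ZB => C k p.1 p.2 :=
    (hCcont k).comp_continuous (f := fun p : Z k × ZB => ((p.1 : Euc (d k)), (p.2 : Euc d')))
      (by fun_prop) fun p => ⟨p.1.2, p.2.2⟩
  have hJ : Continuous J := by
    refine continuous_finsetSum _ fun k _ => continuous_const.mul ?_
    exact (ProbabilityMeasure.continuous_integral_boundedContinuousFunction
      (BoundedContinuousFunction.mkOfCompact ⟨_, hcont k⟩)).comp (continuous_apply k)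
  obtain ⟨y, hy⟩ := hZBne
  have hdirac : Measure.dirac y ZB = 1 := by simp [Measure.dirac_apply' y hZB, hy]
  obtain ⟨ν₀, hν₀, -⟩ := exists_mem_jointPlans hZ hZB P' hPsupp hdirac
    fun k => Classical.choice (inferInstanceAs (Nonempty (Coupling (P k) (Measure.dirac y))))
  obtain ⟨ν, hν, hmin⟩ := (isClosed_jointPlans Z ZB P').isCompact.exists_isMinOn
    ⟨ν₀, hν₀⟩ hJ.continuousOn
  have hlower (Q : Measure (Euc d')) (hQp : IsProbabilityMeasure Q) (hQ : Q ZB = 1) :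
      J ν ≤ ∑ k, lam k * OTcost (C k) (P k) Q := by
    refine le_of_forall_pos_le_add fun ε hε => ?_
    have hnear k : ∃ π : Coupling (P k) Q, ∫ p, C k p.1 p.2 ∂π.1 < OTcost (C k) (P k) Q + ε :=
      exists_lt_of_ciInf_lt (lt_add_of_pos_right _ hε)
    choose π hπ using hnear
    obtain ⟨η, hη, hηπ⟩ := exists_mem_jointPlans hZ hZB P' hPsupp hQ π
    calc J ν ≤ J η := hmin hη
      _ ≤ ∑ k, lam k * (OTcost (C k) (P k) Q + ε) := by
        refine Finset.sum_le_sum fun k _ => mul_le_mul_of_nonneg_left ?_ (hlam k).le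
        refine le_trans (le_of_eq ?_) (hπ k).le
        rw [← hηπ k, (measurableEmbedding_prodIncl (hZ k) hZB).integral_map]
        rfl
      _ = ∑ k, lam k * OTcost (C k) (P k) Q + ε := by
        simp only [mul_add, Finset.sum_add_distrib, ← Finset.sum_mul, hlamsum, one_mul]
  let R : ProbabilityMeasure ZB := (ν ⟨0, hK⟩).map (f := Prod.snd) (by fun_prop)
  let Q : Measure (Euc d') := (R : Measure ZB).map Subtype.val
  have hQp : IsProbabilityMeasure Q :=
    Measure.isProbabilityMeasure_map measurable_subtype_coe.aemeasurable
  have hQ : Q ZB = 1 := by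
    rw [Measure.map_apply measurable_subtype_coe hZB]
    simp
  have hupper : ∑ k, lam k * OTcost (C k) (P k) Q ≤ J ν := by
    refine Finset.sum_le_sum fun k _ => mul_le_mul_of_nonneg_left ?_ (hlam k).le
    have hincl := measurableEmbedding_prodIncl (hZ k) hZB
    have hfst : ((ν k : Measure (Z k × ZB)).map (prodIncl (Z k) ZB)).map Prod.fst = P k := by
      rw [Measure.map_map measurable_fst hincl.measurable]
      exact congrArg Subtype.val (hν.1 k)
    have hsnd : ((ν k : Measure (Z k × ZB)).map (prodIncl (Z k) ZB)).map Prod.snd = Q := by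
      have h : (ν k : Measure (Z k × ZB)).map Prod.snd = R :=
        congrArg Subtype.val (hν.2 k ⟨0, hK⟩)
      rw [Measure.map_map measurable_snd hincl.measurable]
      simp only [Q, ← h]
      rw [Measure.map_map measurable_subtype_coe measurable_snd]
      rfl
    have h := OTcost_le_integral_s7 (hZ k) hZB (hPsupp k) hQ (hCnonneg k)
      ⟨_, Measure.isProbabilityMeasure_map hincl.measurable.aemeasurable, hfst, hsnd⟩
    rwa [hincl.integral_map] at h
  have : Nonempty {Q : Measure (Euc d') // IsProbabilityMeasure Q ∧ Q ZB = 1} := ⟨⟨Q, hQp, hQ⟩⟩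
  refine ⟨Q, hQp, hQ, le_antisymm (le_ciInf fun Q' => ?_) ?_⟩
  · exact hupper.trans (hlower Q'.1 Q'.2.1 Q'.2.2)
  · refine ciInf_le ⟨J ν, ?_⟩ (⟨Q, hQp, hQ⟩ : {Q : Measure (Euc d') // _})
    rintro _ ⟨Q', rfl⟩
    exact hlower Q'.1 Q'.2.1 Q'.2.2
end
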